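/- arXiv:math/0411650 — 4 statements merged into one kernel-verified Lean document; each statement's English description precedes it below -/
import Mathlib

section
/- (Classical Faà di Bruno formula.) For every integer κ ≥ 1 and every x ∈ ℝ, the κ-th derivative of h = f ∘ g is given by: d^κ h/dx^κ (x) = Σ_{d=1}^{κ} Σ_{1≤λ_1<⋯<λ_d≤κ} Σ_{μ_1≥1,…,μ_d≥1 with μ_1λ_1+⋯+μ_dλ_d = κ} [ κ! / ((λ_1!)^{μ_1} μ_1! ⋯ (λ_d!)^{μ_d} μ_d!) ] · f^{(μ_1+⋯+μ_d)}(g(x)) · (g^{(λ_1)}(x))^{μ_1} ⋯ (g^{(λ_d)}(x))^{μ_d}. -/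
section Aux
open Nat Finset

noncomputable def fdbT (F G : ℕ → ℝ) (s : Multiset ℕ) : ℝ :=
  F s.card * (s.map G).prod / ((s.map (fun i => ((i ! : ℕ) : ℝ))).prod
    * ∏ i ∈ s.toFinset, (((s.count i)! : ℕ) : ℝ))

lemma fdb_facprod_cons (i : ℕ) (s : Multiset ℕ) :
    (∏ j ∈ (i ::ₘ s).toFinset, ((((i ::ₘ s).count j)! : ℕ) : ℝ))
      = (s.count i + 1) * ∏ j ∈ s.toFinset, (((s.count j)! : ℕ) : ℝ) := by
  have h1 : (∏ j ∈ s.toFinset, (((s.count j)! : ℕ) : ℝ))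
      = ∏ j ∈ (i ::ₘ s).toFinset, (((s.count j)! : ℕ) : ℝ) := by
    apply Finset.prod_subset
    · intro j hj; simp at hj ⊢; exact Or.inr hj
    · intro j _ hj
      have : j ∉ s := by simpa using hj
      simp [Multiset.count_eq_zero_of_notMem this]
  have h2 : ((s.count i : ℝ) + 1)
      = ∏ j ∈ (i ::ₘ s).toFinset, (if j = i then ((s.count i : ℝ) + 1) else 1) := by
    rw [Finset.prod_ite_eq']; simp
  rw [h1, h2, ← Finset.prod_mul_distrib]
  refine Finset.prod_congr rfl fun j _ => ?_
  by_cases h : j = i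
  · subst h; simp [Nat.factorial_succ]
  · simp [h]

lemma fdbT_cons (F G : ℕ → ℝ) (i : ℕ) (s : Multiset ℕ) :
    ((i ::ₘ s).count i : ℝ) * fdbT F G (i ::ₘ s) =
      fdbT (fun j => F (j + 1)) G s * (G i / (i ! : ℕ)) := by
  have hne : ((s.count i : ℝ) + 1) ≠ 0 := by positivity
  unfold fdbT
  rw [fdb_facprod_cons]
  simp only [Multiset.card_cons, Multiset.map_cons, Multiset.prod_cons, Multiset.count_cons_self]
  push_cast
  simp only [div_eq_mul_inv, mul_inv]
  field_simp

lemma fdb_rec (F G : ℕ → ℝ) (n : ℕ) :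
    ((n : ℝ) + 1) * ∑ p : Nat.Partition (n + 1), fdbT F G p.parts =
      ∑ k ∈ range (n + 1), ∑ q : Nat.Partition (n - k),
        fdbT (fun j => F (j + 1)) G q.parts * (G (k + 1) / (k ! : ℕ)) := by
  have h1 : ∀ p : Nat.Partition (n + 1), ((n : ℝ) + 1) * fdbT F G p.parts
      = ∑ i ∈ p.parts.toFinset, (i : ℝ) * ((p.parts.count i : ℝ) * fdbT F G p.parts) := by
    intro p
    have h := p.parts_sum
    rw [Finset.sum_multiset_count] at h
    have h' : ((n : ℝ) + 1) = ∑ i ∈ p.parts.toFinset, (p.parts.count i : ℝ) * i := by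
      have := congrArg (Nat.cast : ℕ → ℝ) h
      push_cast at this
      simpa using this.symm
    rw [h', Finset.sum_mul]
    exact Finset.sum_congr rfl fun i _ => by ring
  rw [Finset.mul_sum, Finset.sum_congr rfl fun p _ => h1 p, Finset.sum_sigma', Finset.sum_sigma']
  symm
  refine Finset.sum_bij (fun a ha => ⟨⟨(a.1 + 1) ::ₘ a.2.parts, ?_, ?_⟩, a.1 + 1⟩) ?_ ?_ ?_ ?_
  · intro i hi
    rcases Multiset.mem_cons.1 hi with h | h
    · omega
    · exact a.2.parts_pos h
  · have := a.2.parts_sum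
    simp at ha
    simp [this]; omega
  · intro a ha; simp
  · rintro ⟨a, p⟩ ha ⟨b, q⟩ hb h
    simp only [Sigma.mk.injEq, heq_eq_eq, Nat.Partition.mk.injEq] at h
    obtain ⟨h1, h2⟩ := h
    obtain rfl : a = b := by omega
    have : p = q := by
      apply Nat.Partition.ext
      simpa using h1
    rw [this]
  · rintro ⟨p, i⟩ hp
    simp only [Finset.mem_sigma, Finset.mem_univ, true_and, Multiset.mem_toFinset] at hp
    have hpos := p.parts_pos hp
    obtain ⟨k, rfl⟩ : ∃ k, i = k + 1 := ⟨i - 1, by omega⟩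
    obtain ⟨t, ht⟩ := Multiset.exists_cons_of_mem hp
    have hs := p.parts_sum
    rw [ht, Multiset.sum_cons] at hs
    refine ⟨⟨k, ⟨t, fun {j} hj => p.parts_pos (by rw [ht]; simp [hj]), by omega⟩⟩, ?_, ?_⟩
    · simp; omega
    · simp only [Sigma.mk.injEq, heq_eq_eq, and_true]
      apply Nat.Partition.ext
      exact ht.symm
  · rintro ⟨a, p⟩ ha
    simp only
    rw [fdbT_cons, Nat.factorial_succ]
    push_cast
    have : (a : ℝ) + 1 ≠ 0 := by positivity
    have : ((a ! : ℕ) : ℝ) ≠ 0 := by positivity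
    field_simp

theorem fdb_partition (g : ℝ → ℝ) (hg : ContDiff ℝ (⊤ : ℕ∞) g) (x : ℝ) (n : ℕ) :
    ∀ f : ℝ → ℝ, ContDiff ℝ (⊤ : ℕ∞) f →
    iteratedDeriv n (fun t => f (g t)) x = (n ! : ℕ) * ∑ p : Nat.Partition n,
      fdbT (fun j => iteratedDeriv j f (g x)) (fun j => iteratedDeriv j g x) p.parts := by
  induction n using Nat.strong_induction_on with
  | _ n ih =>
  intro f hf
  cases n with
  | zero => simp [fdbT]
  | succ n =>
    have hf' : ContDiff ℝ (⊤ : ℕ∞) (deriv f) := (contDiff_infty_iff_deriv.1 hf).2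
    have hg' : ContDiff ℝ (⊤ : ℕ∞) (deriv g) := (contDiff_infty_iff_deriv.1 hg).2
    have hd : deriv (fun t => f (g t)) = fun t => deriv g t * deriv f (g t) := by
      funext t
      have := ((hf.differentiable (by simp)) (g t)).hasDerivAt.comp t
        ((hg.differentiable (by simp)) t).hasDerivAt
      rw [mul_comm]
      exact this.deriv
    rw [iteratedDeriv_succ', hd]
    have hfg : ContDiff ℝ (⊤ : ℕ∞) (fun t => deriv f (g t)) := hf'.comp hg
    rw [iteratedDeriv_fun_mul (hg'.contDiffAt.of_le (by exact_mod_cast le_top))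
      (hfg.contDiffAt.of_le (by exact_mod_cast le_top))]
    rw [Nat.factorial_succ]
    push_cast
    rw [mul_comm ((n : ℝ) + 1), mul_assoc, fdb_rec, Finset.mul_sum]
    refine Finset.sum_congr rfl fun k hk => ?_
    have hk' : k ≤ n := by simp at hk; omega
    have := ih (n - k) (by omega) (deriv f) hf'
    rw [this, ← Finset.sum_mul]
    simp only [← iteratedDeriv_succ']
    have hc := Nat.choose_mul_factorial_mul_factorial hk'
    rw [← hc]
    have : ((k ! : ℕ) : ℝ) ≠ 0 := by positivity
    push_cast
    field_simp

def fdbM {d : ℕ} (lam mu : Fin d → ℕ) : Multiset ℕ :=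
  ∑ e, Multiset.replicate (mu e) (lam e)

lemma fdbM_count {d : ℕ} (lam mu : Fin d → ℕ) (hl : Function.Injective lam) (e : Fin d) :
    (fdbM lam mu).count (lam e) = mu e := by
  unfold fdbM
  rw [Multiset.count_sum']
  simp only [Multiset.count_replicate, hl.eq_iff]
  simp

lemma fdbM_toFinset {d : ℕ} (lam mu : Fin d → ℕ) (hm : ∀ e, 1 ≤ mu e) :
    (fdbM lam mu).toFinset = Finset.univ.image lam := by
  ext a
  simp only [fdbM, Multiset.mem_toFinset, Multiset.mem_sum, Finset.mem_image, Finset.mem_univ,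
    true_and, Multiset.mem_replicate]
  constructor
  · rintro ⟨e, _, h⟩; exact ⟨e, h.symm⟩
  · rintro ⟨e, h⟩; exact ⟨e, by have := hm e; omega, h.symm⟩

lemma fdbM_prod_map {d : ℕ} (lam mu : Fin d → ℕ) (G : ℕ → ℝ) :
    ((fdbM lam mu).map G).prod = ∏ e, G (lam e) ^ mu e := by
  unfold fdbM
  induction (Finset.univ : Finset (Fin d)) using Finset.induction_on with
  | empty => simp
  | insert a s ha ih => simp [Finset.sum_insert ha, Finset.prod_insert ha, ih]

lemma fdbM_card {d : ℕ} (lam mu : Fin d → ℕ) : (fdbM lam mu).card = ∑ e, mu e := by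
  simp [fdbM]

lemma fdbM_sum {d : ℕ} (lam mu : Fin d → ℕ) : (fdbM lam mu).sum = ∑ e, mu e * lam e := by
  simp [fdbM, Multiset.sum_sum]

lemma fdbT_fdbM {d : ℕ} (F G : ℕ → ℝ) (lam mu : Fin d → ℕ) (hl : Function.Injective lam)
    (hm : ∀ e, 1 ≤ mu e) :
    fdbT F G (fdbM lam mu) = F (∑ e, mu e) * (∏ e, G (lam e) ^ mu e) /
      ((∏ e, (Nat.factorial (lam e)) ^ (mu e) * Nat.factorial (mu e) : ℕ) : ℝ) := by
  unfold fdbT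
  rw [fdbM_card, fdbM_prod_map, fdbM_prod_map, fdbM_toFinset lam mu hm,
    Finset.prod_image (fun a _ b _ h => hl h)]
  simp only [fdbM_count lam mu hl]
  push_cast
  rw [Finset.prod_mul_distrib]

lemma fdbM_inj {d d' : ℕ} (lam mu : Fin d → ℕ) (lam' mu' : Fin d' → ℕ)
    (hl : StrictMono lam) (hm : ∀ e, 1 ≤ mu e) (hl' : StrictMono lam') (hm' : ∀ e, 1 ≤ mu' e)
    (h : fdbM lam mu = fdbM lam' mu') :
    (⟨⟨d, lam⟩, mu⟩ : Σ a : (Σ d : ℕ, (Fin d → ℕ)), (Fin a.1 → ℕ)) = ⟨⟨d', lam'⟩, mu'⟩ := by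
  have hF : Finset.univ.image lam = Finset.univ.image lam' := by
    rw [← fdbM_toFinset lam mu hm, h, fdbM_toFinset lam' mu' hm']
  have hd : d = d' := by
    have := congrArg Finset.card hF
    rwa [Finset.card_image_of_injective _ hl.injective,
      Finset.card_image_of_injective _ hl'.injective, Finset.card_fin, Finset.card_fin] at this
  subst hd
  have hlam : lam = lam' := by
    rw [← hl.range_inj hl']
    have := congrArg (fun s : Finset ℕ => (s : Set ℕ)) hF
    simpa using this
  subst hlam
  have hmu : mu = mu' := by
    funext e
    rw [← fdbM_count lam mu hl.injective e, h, fdbM_count lam mu' hl.injective e]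
  rw [hmu]

lemma fdbM_surj (s : Multiset ℕ) :
    fdbM (s.toFinset.orderEmbOfFin rfl) (fun e => s.count (s.toFinset.orderEmbOfFin rfl e)) = s := by
  unfold fdbM
  conv_rhs => rw [← Multiset.toFinset_sum_count_nsmul_eq s]
  conv_rhs => rw [← Finset.image_orderEmbOfFin_univ s.toFinset rfl]
  rw [Finset.sum_image (fun a _ b _ h => (s.toFinset.orderEmbOfFin rfl).injective h)]
  simp [Multiset.nsmul_singleton]

end Aux

/-- The classical Faà di Bruno formula for the κ-th derivative of a composition
`h = f ∘ g` of two smooth functions `ℝ → ℝ`. -/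
theorem faa_di_bruno_classical
    (f g : ℝ → ℝ) (hf : ContDiff ℝ (⊤ : ℕ∞) f) (hg : ContDiff ℝ (⊤ : ℕ∞) g)
    (κ : ℕ) (hκ : 1 ≤ κ) (x : ℝ) :
    iteratedDeriv κ (fun t => f (g t)) x =
      ∑ d ∈ Finset.Icc 1 κ,
        ∑ lam ∈ (Fintype.piFinset fun _ : Fin d => Finset.Icc 1 κ).filter
            (fun lam => ∀ a b : Fin d, a < b → lam a < lam b),
        ∑ mu ∈ (Fintype.piFinset fun _ : Fin d => Finset.Icc 1 κ).filter
            (fun mu => ∑ e, mu e * lam e = κ),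
          ((κ.factorial : ℝ)
              / ((∏ e, (Nat.factorial (lam e)) ^ (mu e) * Nat.factorial (mu e) : ℕ) : ℝ))
            * iteratedDeriv (∑ e, mu e) f (g x)
            * ∏ e, (iteratedDeriv (lam e) g x) ^ (mu e) := by
  rw [fdb_partition g hg x κ f hf]
  rw [Finset.mul_sum, Finset.sum_sigma', Finset.sum_sigma']
  symm
  have key : ∀ a ∈ ((Finset.Icc 1 κ).sigma fun d =>
      (Fintype.piFinset fun _ : Fin d => Finset.Icc 1 κ).filter
            (fun lam => ∀ a b : Fin d, a < b → lam a < lam b)).sigma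
      fun a => (Fintype.piFinset fun _ : Fin a.1 => Finset.Icc 1 κ).filter
            (fun mu => ∑ e, mu e * a.2 e = κ),
      StrictMono a.1.2 ∧ (∀ e, 1 ≤ a.1.2 e) ∧ (∀ e, 1 ≤ a.2 e) ∧ ∑ e, a.2 e * a.1.2 e = κ := by
    rintro ⟨⟨d, lam⟩, mu⟩ ha
    simp only [Finset.mem_sigma, Finset.mem_filter, Fintype.mem_piFinset, Finset.mem_Icc] at ha
    exact ⟨fun a b h => ha.1.2.2 a b h, fun e => (ha.1.2.1 e).1, fun e => (ha.2.1 e).1, ha.2.2⟩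
  refine Finset.sum_bij (fun a ha => ⟨fdbM a.1.2 a.2, ?_, ?_⟩) ?_ ?_ ?_ ?_
  · intro i hi
    have h1 := Multiset.mem_toFinset.2 hi
    rw [fdbM_toFinset _ _ (key a ha).2.2.1] at h1
    obtain ⟨e, _, rfl⟩ := Finset.mem_image.1 h1
    exact (key a ha).2.1 e
  · rw [fdbM_sum]; exact (key a ha).2.2.2
  · intro a ha; exact Finset.mem_univ _
  · intro a ha b hb h
    have h' := congrArg Nat.Partition.parts h
    have ka := key a ha
    have kb := key b hb
    exact fdbM_inj a.1.2 a.2 b.1.2 b.2 ka.1 ka.2.2.1 kb.1 kb.2.2.1 h'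
  · intro p _
    have hs := fdbM_surj p.parts
    have hsum := p.parts_sum
    refine ⟨⟨⟨p.parts.toFinset.card, p.parts.toFinset.orderEmbOfFin rfl⟩,
      fun e => p.parts.count (p.parts.toFinset.orderEmbOfFin rfl e)⟩, ?_, ?_⟩
    · have hmem : ∀ e, p.parts.toFinset.orderEmbOfFin rfl e ∈ p.parts := fun e =>
        Multiset.mem_toFinset.1 (Finset.orderEmbOfFin_mem _ rfl e)
      have hle : ∀ i ∈ p.parts, i ≤ κ := fun i hi => by
        rw [← hsum]; exact Multiset.le_sum_of_mem hi
      have hcard : p.parts.card ≤ κ := by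
        have := Multiset.card_nsmul_le_sum (s := p.parts) (a := 1) (fun i hi => p.parts_pos hi)
        simpa [hsum] using this
      simp only [Finset.mem_sigma, Finset.mem_filter, Fintype.mem_piFinset, Finset.mem_Icc]
      refine ⟨⟨⟨?_, (Multiset.toFinset_card_le _).trans hcard⟩,
        fun e => ⟨p.parts_pos (hmem e), hle _ (hmem e)⟩,
        fun a b h => (p.parts.toFinset.orderEmbOfFin rfl).strictMono h⟩,
        fun e => ⟨Multiset.one_le_count_iff_mem.2 (hmem e),
          (Multiset.count_le_card _ _).trans hcard⟩, ?_⟩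
      · rw [Nat.one_le_iff_ne_zero, Ne, Finset.card_eq_zero, Multiset.toFinset_eq_empty]
        intro h0
        rw [h0] at hsum
        simp at hsum
        omega
      · rw [← fdbM_sum, hs, hsum]
    · exact Nat.Partition.ext hs
  · intro a ha
    have ka := key a ha
    simp only
    rw [fdbT_fdbM _ _ _ _ ka.1.injective ka.2.2.1]
    ring
end

section
/- (Multivariate Faà di Bruno formula, several independent variables and one dependent variable.) For every integer κ ≥ 1 and every choice of indices i_1, …, i_κ ∈ {1,…,n}: ∂^κ h / (∂x^{i_1} ⋯ ∂x^{i_κ}) (x) = Σ_{d=1}^{κ} Σ_{1≤λ_1<⋯<λ_d≤κ} Σ_{μ_1≥1,…,μ_d≥1 with μ_1λ_1+⋯+μ_dλ_d = κ} f^{(μ_1+⋯+μ_d)}(g(x)) · [ Σ_{σ ∈ F^{(μ,λ)}_κ} Π_{e=1}^{d} Π_{ν=1}^{μ_e} ∂^{λ_e} g / (∂x^{i_{σ(e:ν:1)}} ⋯ ∂x^{i_{σ(e:ν:λ_e)}}) (x) ], where {1,…,κ} is identified with the set of triples (e:ν:γ) as described, and the inner sum is independent of the choice of coset representatives F^{(μ,λ)}_κ.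 -/
/-- Iterated partial derivative of `F : ℝⁿ → ℝ` with respect to the coordinates listed
in `xs`. -/
noncomputable def pdl {n : ℕ} : List (Fin n) → ((Fin n → ℝ) → ℝ) → ((Fin n → ℝ) → ℝ)
  | [], F => F
  | a :: l, F => fun x => deriv (fun t => pdl l F (Function.update x a t)) (x a)

/-- The index set of triples `(e:ν:γ)` attached to block data: for `e : Fin d` there are
`mu' e + 1` blocks (indexed by `ν`), each of size `lam' e + 1` (positions indexed by `γ`).
(The data `lam', mu'` are the numbers `λ_e - 1`, `μ_e - 1`, so that `λ_e, μ_e ≥ 1`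
automatically.) -/
abbrev Triple (d : ℕ) (lam' mu' : Fin d → ℕ) : Type :=
  (e : Fin d) × (Fin (mu' e + 1) × Fin (lam' e + 1))

/-- Lexicographic position (0-indexed) of a triple inside `{0,…,N-1}`,
`N = Σ_e μ_e λ_e`. -/
def encT {d : ℕ} (lam' mu' : Fin d → ℕ) (t : Triple d lam' mu') : ℕ :=
  (∑ e' ∈ Finset.univ.filter (fun e' : Fin d => e' < t.1), (mu' e' + 1) * (lam' e' + 1))
    + (t.2.1 : ℕ) * (lam' t.1 + 1) + (t.2.2 : ℕ)

/-- Membership in the subgroup `H`: a permutation of the triples belongs to `H` iff it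
maps each block `(e,ν)` setwise onto some block `(e,ν')` with the same family index. -/
def inH {d : ℕ} (lam' mu' : Fin d → ℕ) (σ : Equiv.Perm (Triple d lam' mu')) : Prop :=
  ∀ (e : Fin d) (ν : Fin (mu' e + 1)) (γ γ' : Fin (lam' e + 1)),
    (σ ⟨e, (ν, γ)⟩).1 = e ∧ ((σ ⟨e, (ν, γ)⟩).2.1 : ℕ) = ((σ ⟨e, (ν, γ')⟩).2.1 : ℕ)

/-- pdl of a cons as a directional derivative -/
lemma pdl_cons_eq {n : ℕ} (a : Fin n) (l : List (Fin n)) (F : (Fin n → ℝ) → ℝ)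
    (h : Differentiable ℝ (pdl l F)) (x : Fin n → ℝ) :
    pdl (a :: l) F x = fderiv ℝ (pdl l F) x (Pi.single a 1) := by
  have h1 : HasDerivAt (fun t => Function.update x a t) (Pi.single a 1) (x a) :=
    hasDerivAt_update x a (x a)
  have h2 : HasFDerivAt (pdl l F) (fderiv ℝ (pdl l F) x) (Function.update x a (x a)) := by
    rw [Function.update_eq_self]; exact (h x).hasFDerivAt
  have h3 := h2.comp_hasDerivAt (x a) h1
  exact h3.deriv

lemma pdl_contDiff {n : ℕ} (F : (Fin n → ℝ) → ℝ) (hF : ContDiff ℝ (⊤ : ℕ∞) F)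
    (l : List (Fin n)) : ContDiff ℝ (⊤ : ℕ∞) (pdl l F) := by
  induction l with
  | nil => exact hF
  | cons a l ih =>
    have hd : Differentiable ℝ (pdl l F) := ih.differentiable (by simp)
    have : pdl (a :: l) F = fun x => fderiv ℝ (pdl l F) x (Pi.single a 1) :=
      funext (pdl_cons_eq a l F hd)
    rw [this]
    exact (ih.fderiv_right (m := (⊤ : ℕ∞)) (by simp)).clm_apply contDiff_const

lemma pdl_cons {n : ℕ} (F : (Fin n → ℝ) → ℝ) (hF : ContDiff ℝ (⊤ : ℕ∞) F)
    (a : Fin n) (l : List (Fin n)) (x : Fin n → ℝ) :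
    pdl (a :: l) F x = fderiv ℝ (pdl l F) x (Pi.single a 1) :=
  pdl_cons_eq a l F ((pdl_contDiff F hF l).differentiable (by simp)) x

lemma pdl_perm {n : ℕ} (F : (Fin n → ℝ) → ℝ) (hF : ContDiff ℝ (⊤ : ℕ∞) F)
    {l l' : List (Fin n)} (h : l.Perm l') : pdl l F = pdl l' F := by
  induction h with
  | nil => rfl
  | cons a _ ih => funext x; simp only [pdl, ih]
  | swap a b l =>
    have key : ∀ (a b : Fin n) (x : Fin n → ℝ), pdl (a :: b :: l) F x =
        fderiv ℝ (fderiv ℝ (pdl l F)) x (Pi.single a 1) (Pi.single b 1) := by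
      intro a b x
      have e : pdl (b :: l) F = fun x => fderiv ℝ (pdl l F) x (Pi.single b 1) :=
        funext (pdl_cons F hF b l)
      rw [pdl_cons F hF, e]
      have hd : DifferentiableAt ℝ (fderiv ℝ (pdl l F)) x :=
        (((pdl_contDiff F hF l).fderiv_right (m := (⊤ : ℕ∞)) (by simp)).differentiable
          (by simp)) x
      rw [fderiv_clm_apply hd (differentiableAt_const _)]
      simp
    funext x
    rw [key, key]
    have hs : IsSymmSndFDerivAt ℝ (pdl l F) x :=
      (pdl_contDiff F hF l).contDiffAt.isSymmSndFDerivAt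
        (by simp only [minSmoothness_of_isRCLikeNormedField]; exact WithTop.coe_le_coe.2 (le_top : (2 : ℕ∞) ≤ ⊤))
    exact hs _ _
  | trans _ _ h1 h2 => exact h1.trans h2

lemma pdl_ofFn {n : ℕ} (F : (Fin n → ℝ) → ℝ) (hF : ContDiff ℝ (⊤ : ℕ∞) F)
    (k : ℕ) (i : Fin k → Fin n) (x : Fin n → ℝ) :
    pdl (List.ofFn i) F x = iteratedFDeriv ℝ k F x (fun j => Pi.single (i j) 1) := by
  induction k generalizing x with
  | zero => simp [pdl]
  | succ k ih =>
    rw [List.ofFn_succ, pdl_cons F hF, iteratedFDeriv_succ_apply_left]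
    have e : pdl (List.ofFn fun j => i (Fin.succ j)) F =
        fun x => iteratedFDeriv ℝ k F x (fun j => Pi.single (i j.succ) 1) := funext (ih _)
    rw [e]
    have hd : DifferentiableAt ℝ (iteratedFDeriv ℝ k F) x :=
      (hF.differentiable_iteratedFDeriv (m := k) (by exact_mod_cast WithTop.coe_lt_top k)) x
    have := hd.hasFDerivAt.continuousMultilinear_apply_const
      (fun j : Fin k => (Pi.single (i j.succ) 1 : Fin n → ℝ))
    rw [this.fderiv]
    rfl

/-- the derivative of `g` along the indices in a block -/
noncomputable def Dblk {n κ : ℕ} (g : (Fin n → ℝ) → ℝ) (i : Fin κ → Fin n) (x : Fin n → ℝ)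
    (B : Finset (Fin κ)) : ℝ := pdl (B.toList.map i) g x

lemma pdl_eq_Dblk {n κ : ℕ} (g : (Fin n → ℝ) → ℝ) (hg : ContDiff ℝ (⊤ : ℕ∞) g)
    (i : Fin κ → Fin n) (x : Fin n → ℝ) {m : ℕ} (φ : Fin m → Fin κ) (hφ : Function.Injective φ) :
    pdl (List.ofFn (fun j => i (φ j))) g x = Dblk g i x (Finset.univ.image φ) := by
  unfold Dblk
  have h : (List.ofFn (fun j => i (φ j))) = (List.ofFn φ).map i := by
    rw [List.map_ofFn]; rfl
  rw [h]
  refine congrFun (pdl_perm g hg (List.Perm.map i ?_)) x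
  rw [List.perm_ext_iff_of_nodup (List.nodup_ofFn.2 hφ) (Finset.nodup_toList _)]
  intro a
  simp [List.mem_ofFn]

lemma lhs_eq {n : ℕ} (g : (Fin n → ℝ) → ℝ) (f : ℝ → ℝ)
    (hg : ContDiff ℝ (⊤ : ℕ∞) g) (hf : ContDiff ℝ (⊤ : ℕ∞) f)
    (κ : ℕ) (i : Fin κ → Fin n) (x : Fin n → ℝ) :
    pdl (List.ofFn i) (fun z => f (g z)) x =
      ∑ c : OrderedFinpartition κ, iteratedDeriv c.length f (g x) *
        ∏ m, Dblk g i x (Finset.univ.image (c.emb m)) := by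
  have e : (fun z => f (g z)) = f ∘ g := rfl
  rw [e, pdl_ofFn _ (hf.comp hg)]
  have := iteratedFDeriv_comp (𝕜 := ℝ) (g := f) (f := g) (x := x) (n := (⊤ : ℕ∞)) hf.contDiffAt
    hg.contDiffAt (i := κ) (by exact_mod_cast le_top)
  rw [this, FormalMultilinearSeries.taylorComp, sum_apply]
  refine Finset.sum_congr rfl fun c _ => ?_
  rw [FormalMultilinearSeries.compAlongOrderedFinpartition_apply]
  simp only [ftaylorSeries]
  rw [iteratedFDeriv_apply_eq_iteratedDeriv_mul_prod, smul_eq_mul, mul_comm]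
  congr 1
  refine Finset.prod_congr rfl fun m _ => ?_
  rw [← pdl_eq_Dblk g hg i x _ (c.emb_strictMono m).injective, pdl_ofFn g hg]
  rfl
/-- the parts `P` form a set partition of `Fin κ` -/
def IsPart {κ : ℕ} (P : Finset (Finset (Fin κ))) : Prop :=
  (∀ B ∈ P, B.Nonempty) ∧ (∀ B ∈ P, ∀ C ∈ P, ∀ a, a ∈ B → a ∈ C → B = C) ∧
    ∀ a, ∃ B ∈ P, a ∈ B

lemma IsPart.eq_of_subset {κ : ℕ} {P Q : Finset (Finset (Fin κ))} (hP : IsPart P)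
    (hQ : IsPart Q) (h : P ⊆ Q) : P = Q := by
  refine Finset.Subset.antisymm h fun B hB => ?_
  obtain ⟨a, ha⟩ := hQ.1 B hB
  obtain ⟨C, hC, haC⟩ := hP.2.2 a
  rw [hQ.2.1 B hB C (h hC) a ha haC]
  exact hC

/-- image of a part of an ordered finpartition -/
def ofpBlk {κ : ℕ} (c : OrderedFinpartition κ) (m : Fin c.length) : Finset (Fin κ) :=
  Finset.univ.image (c.emb m)

def ofpParts {κ : ℕ} (c : OrderedFinpartition κ) : Finset (Finset (Fin κ)) :=
  Finset.univ.image (ofpBlk c)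

lemma mem_ofpBlk {κ : ℕ} (c : OrderedFinpartition κ) (m : Fin c.length) (a : Fin κ) :
    a ∈ ofpBlk c m ↔ ∃ r, c.emb m r = a := by simp [ofpBlk]

lemma ofpBlk_inter {κ : ℕ} (c : OrderedFinpartition κ) (m m' : Fin c.length) (a : Fin κ)
    (h : a ∈ ofpBlk c m) (h' : a ∈ ofpBlk c m') : m = m' := by
  obtain ⟨r, hr⟩ := (mem_ofpBlk c m a).1 h
  obtain ⟨r', hr'⟩ := (mem_ofpBlk c m' a).1 h'
  by_contra hne
  exact c.emb_ne_emb_of_ne hne (hr.trans hr'.symm)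

lemma ofpBlk_nonempty {κ : ℕ} (c : OrderedFinpartition κ) (m : Fin c.length) :
    (ofpBlk c m).Nonempty := ⟨_, (mem_ofpBlk c m _).2 ⟨⟨0, c.partSize_pos m⟩, rfl⟩⟩

lemma ofpBlk_inj {κ : ℕ} (c : OrderedFinpartition κ) : Function.Injective (ofpBlk c) := by
  intro m m' h
  obtain ⟨a, ha⟩ := ofpBlk_nonempty c m
  exact ofpBlk_inter c m m' a ha (h ▸ ha)

lemma ofpParts_isPart {κ : ℕ} (c : OrderedFinpartition κ) : IsPart (ofpParts c) := by
  refine ⟨?_, ?_, ?_⟩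
  · intro B hB
    obtain ⟨m, -, rfl⟩ := Finset.mem_image.1 hB
    exact ofpBlk_nonempty c m
  · intro B hB C hC a ha ha'
    obtain ⟨m, -, rfl⟩ := Finset.mem_image.1 hB
    obtain ⟨m', -, rfl⟩ := Finset.mem_image.1 hC
    rw [ofpBlk_inter c m m' a ha ha']
  · intro a
    obtain ⟨m, r, hr⟩ := c.cover a
    exact ⟨ofpBlk c m, Finset.mem_image_of_mem _ (Finset.mem_univ _), (mem_ofpBlk c m a).2 ⟨r, hr⟩⟩

lemma ofpBlk_card {κ : ℕ} (c : OrderedFinpartition κ) (m : Fin c.length) :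
    (ofpBlk c m).card = c.partSize m := by
  rw [ofpBlk, Finset.card_image_of_injective _ (c.emb_strictMono m).injective]; simp

lemma ofpParts_card {κ : ℕ} (c : OrderedFinpartition κ) : (ofpParts c).card = c.length := by
  rw [ofpParts, Finset.card_image_of_injective _ (ofpBlk_inj c)]; simp

/-- maximum with junk value -/
def mx {κ : ℕ} (B : Finset (Fin κ)) : WithBot (Fin κ) := B.max

lemma mx_ofpBlk {κ : ℕ} (c : OrderedFinpartition κ) (m : Fin c.length) :
    mx (ofpBlk c m) =
      c.emb m ⟨c.partSize m - 1, Nat.sub_one_lt_of_lt (c.partSize_pos m)⟩ := by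
  apply le_antisymm
  · refine Finset.max_le fun a ha => ?_
    obtain ⟨r, rfl⟩ := (mem_ofpBlk c m a).1 ha
    refine WithBot.coe_le_coe.2 ((c.emb_strictMono m).monotone ?_)
    rw [Fin.le_def]; have := r.2; simp only; omega
  · exact Finset.le_max ((mem_ofpBlk c m _).2 ⟨_, rfl⟩)

lemma mx_ofpBlk_strictMono {κ : ℕ} (c : OrderedFinpartition κ) :
    StrictMono (fun m => mx (ofpBlk c m)) := by
  intro m m' h
  simp only [mx_ofpBlk]
  exact WithBot.coe_lt_coe.2 (c.parts_strictMono h)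

lemma ofpParts_inj {κ : ℕ} (c c' : OrderedFinpartition κ) (h : ofpParts c = ofpParts c') :
    c = c' := by
  have hl : c.length = c'.length := by rw [← ofpParts_card, ← ofpParts_card, h]
  have hm : ∀ m : Fin c.length, ofpBlk c m = ofpBlk c' (Fin.cast hl m) := by
    have h1 : (fun m => mx (ofpBlk c m)) = fun m => mx (ofpBlk c' (Fin.cast hl m)) := by
      have hs2 : StrictMono (fun m => mx (ofpBlk c' (Fin.cast hl m))) :=
        (mx_ofpBlk_strictMono c').comp (fun a b hab => by simpa using hab)
      rw [← (mx_ofpBlk_strictMono c).range_inj hs2]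
      have r1 : Set.range (fun m => mx (ofpBlk c m)) = mx '' (ofpParts c : Set (Finset (Fin κ))) := by
        ext; simp [ofpParts]
      have r2 : Set.range (fun m => mx (ofpBlk c' (Fin.cast hl m))) =
          mx '' (ofpParts c' : Set (Finset (Fin κ))) := by
        ext y; simp only [ofpParts, Finset.coe_image, Finset.coe_univ, Set.image_univ,
          Set.mem_image, Set.mem_range, exists_exists_eq_and]
        exact ⟨fun ⟨m, hm⟩ => ⟨_, hm⟩, fun ⟨m, hm⟩ => ⟨Fin.cast hl.symm m, by simpa using hm⟩⟩
      rw [r1, r2, h]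
    intro m
    have h2 := congrFun h1 m
    have hmem : ofpBlk c m ∈ ofpParts c' := h ▸ Finset.mem_image_of_mem _ (Finset.mem_univ _)
    refine (ofpParts_isPart c').2.1 _ hmem _ (Finset.mem_image_of_mem _ (Finset.mem_univ _))
      (c.emb m ⟨c.partSize m - 1, Nat.sub_one_lt_of_lt (c.partSize_pos m)⟩)
      ((mem_ofpBlk c m _).2 ⟨_, rfl⟩) ?_
    simp only [mx_ofpBlk, WithBot.coe_inj] at h2
    rw [h2]
    exact (mem_ofpBlk _ _ _).2 ⟨_, rfl⟩
  have hsz : ∀ m : Fin c.length, c.partSize m = c'.partSize (Fin.cast hl m) := by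
    intro m; rw [← ofpBlk_card, ← ofpBlk_card, hm]
  have hemb : ∀ (m : Fin c.length) (r : Fin (c.partSize m)),
      c.emb m r = c'.emb (Fin.cast hl m) (Fin.cast (hsz m) r) := by
    intro m r
    have hs2 : StrictMono (fun r => c'.emb (Fin.cast hl m) (Fin.cast (hsz m) r)) :=
      (c'.emb_strictMono _).comp (fun a b hab => by simpa using hab)
    refine congrFun ((StrictMono.range_inj (c.emb_strictMono m) hs2).1 ?_) r
    ext a
    have := Finset.ext_iff.1 (hm m) a
    rw [mem_ofpBlk, mem_ofpBlk] at this
    rw [Set.mem_range, this]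
    exact ⟨fun ⟨r, hr⟩ => ⟨Fin.cast (hsz m).symm r, by simpa using hr⟩, fun ⟨r, hr⟩ => ⟨_, hr⟩⟩
  rcases c with ⟨l, p, hp, e, he, h1, h2, h3⟩
  rcases c' with ⟨l', p', hp', e', he', h1', h2', h3'⟩
  simp only at hl
  subst hl
  have : p = p' := funext hsz
  subst this
  have : e = e' := by funext m r; exact hemb m r
  subst this
  rfl

lemma ofpParts_surj {κ : ℕ} (P : Finset (Finset (Fin κ))) (hP : IsPart P) :
    ∃ c : OrderedFinpartition κ, ofpParts c = P := by
  classical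
  have hcov : ∀ B ∈ P, ∃ a : Fin κ, mx B = a := fun B hB => Finset.max_of_nonempty (hP.1 B hB)
  have hmxmem : ∀ (B : Finset (Fin κ)) (a : Fin κ), mx B = a → a ∈ B :=
    fun B a h => Finset.mem_of_max h
  have hinj : Set.InjOn mx (P : Set (Finset (Fin κ))) := by
    intro B hB C hC h
    obtain ⟨a, ha⟩ := hcov B hB
    exact hP.2.1 B hB C hC a (hmxmem B a ha) (hmxmem C a (h ▸ ha))
  set M : Finset (WithBot (Fin κ)) := P.image mx with hM
  have hMc : M.card = P.card := Finset.card_image_of_injOn hinj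
  have hex : ∀ m : Fin P.card, ∃ B ∈ P, mx B = M.orderEmbOfFin hMc m := fun m =>
    Finset.mem_image.1 (Finset.orderEmbOfFin_mem M hMc m)
  choose blk hblk hmx using hex
  have hsm : StrictMono (fun m => mx (blk m)) := by
    intro a b hab
    simp only [hmx]
    exact (M.orderEmbOfFin hMc).strictMono hab
  have hbi : Function.Injective blk := fun a b h => hsm.injective (by simp only [h])
  have himg : Finset.univ.image blk = P := by
    apply Finset.eq_of_subset_of_card_le
    · intro B hB
      obtain ⟨m, -, rfl⟩ := Finset.mem_image.1 hB
      exact hblk m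
    · rw [Finset.card_image_of_injective _ hbi]; simp
  have hlast : ∀ m, (((blk m).orderEmbOfFin rfl
      ⟨(blk m).card - 1, Nat.sub_one_lt_of_lt (Finset.card_pos.2 (hP.1 _ (hblk m)))⟩ : Fin κ) :
        WithBot (Fin κ)) = mx (blk m) := by
    intro m
    rw [Finset.orderEmbOfFin_last rfl (Finset.card_pos.2 (hP.1 _ (hblk m)))]
    exact Finset.coe_max' _
  refine ⟨⟨P.card, fun m => (blk m).card, fun m => Finset.card_pos.2 (hP.1 _ (hblk m)),
    fun m => (blk m).orderEmbOfFin rfl, fun m => ((blk m).orderEmbOfFin rfl).strictMono,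
    ?_, ?_, ?_⟩, ?_⟩
  · intro a b hab
    have := hsm hab
    simp only [← hlast] at this
    exact WithBot.coe_lt_coe.1 this
  · intro a _ b _ hab
    simp only [Function.onFun, Finset.range_orderEmbOfFin]
    rw [Finset.disjoint_coe, Finset.disjoint_left]
    intro y hy hy'
    exact hab (hbi (hP.2.1 _ (hblk a) _ (hblk b) y hy hy'))
  · intro a
    obtain ⟨B, hB, ha⟩ := hP.2.2 a
    rw [← himg] at hB
    obtain ⟨m, -, rfl⟩ := Finset.mem_image.1 hB
    refine ⟨m, ?_⟩
    rw [Finset.range_orderEmbOfFin]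
    exact ha
  · refine Eq.trans ?_ himg
    unfold ofpParts
    refine Finset.image_congr fun m _ => ?_
    exact Finset.image_orderEmbOfFin_univ _ _

open Classical in
lemma lhs_eq' {n : ℕ} (g : (Fin n → ℝ) → ℝ) (f : ℝ → ℝ)
    (hg : ContDiff ℝ (⊤ : ℕ∞) g) (hf : ContDiff ℝ (⊤ : ℕ∞) f)
    (κ : ℕ) (i : Fin κ → Fin n) (x : Fin n → ℝ) :
    pdl (List.ofFn i) (fun z => f (g z)) x =
      ∑ P ∈ (Finset.univ : Finset (Finset (Finset (Fin κ)))).filter IsPart,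
        iteratedDeriv P.card f (g x) * ∏ B ∈ P, Dblk g i x B := by
  rw [lhs_eq g f hg hf]
  refine Finset.sum_bij (fun c _ => ofpParts c) ?_ ?_ ?_ ?_
  · intro c _; simpa using ofpParts_isPart c
  · intro c _ c' _ h; exact ofpParts_inj c c' h
  · intro P hP
    obtain ⟨c, hc⟩ := ofpParts_surj P (Finset.mem_filter.1 hP).2
    exact ⟨c, Finset.mem_univ _, hc⟩
  · intro c _
    rw [ofpParts_card, ofpParts, Finset.prod_image (fun a _ b _ h => ofpBlk_inj c h)]
    rfl
/-! ### Blocks attached to a bijection from the triples -/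

lemma encT_lt_of_lt {d : ℕ} (lam' mu' : Fin d → ℕ) (t : Triple d lam' mu') :
    encT lam' mu' t < ∑ e' ∈ Finset.univ.filter (fun e' : Fin d => e' ≤ t.1),
      (mu' e' + 1) * (lam' e' + 1) := by
  have h : Finset.univ.filter (fun e' : Fin d => e' ≤ t.1) =
      insert t.1 (Finset.univ.filter (fun e' : Fin d => e' < t.1)) := by
    ext a; simp [le_iff_eq_or_lt]
  rw [h, Finset.sum_insert (by simp)]
  unfold encT
  obtain ⟨e, ν, γ⟩ := t
  have h1 := ν.2
  have h2 := γ.2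
  simp only
  have : (ν : ℕ) * (lam' e + 1) + (lam' e + 1) ≤ (mu' e + 1) * (lam' e + 1) := by
    rw [← Nat.succ_mul]; exact Nat.mul_le_mul_right _ h1
  omega

lemma encT_lt {d κ : ℕ} (lam' mu' : Fin d → ℕ) (t : Triple d lam' mu')
    (h : ∑ e, (mu' e + 1) * (lam' e + 1) = κ) : encT lam' mu' t < κ := by
  refine (encT_lt_of_lt lam' mu' t).trans_le ?_
  rw [← h]
  exact Finset.sum_le_sum_of_subset (Finset.filter_subset _ _)

lemma encT_lt_encT {d : ℕ} (lam' mu' : Fin d → ℕ) (t s : Triple d lam' mu') (h : t.1 < s.1) :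
    encT lam' mu' t < encT lam' mu' s := by
  refine (encT_lt_of_lt lam' mu' t).trans_le ?_
  unfold encT
  rw [add_assoc]
  refine le_add_right (Finset.sum_le_sum_of_subset ?_)
  intro a ha
  simp only [Finset.mem_filter, Finset.mem_univ, true_and] at ha ⊢
  exact lt_of_le_of_lt ha h

lemma encT_inj {d : ℕ} (lam' mu' : Fin d → ℕ) : Function.Injective (encT lam' mu') := by
  intro t s h
  rcases lt_trichotomy t.1 s.1 with hl | hl | hl
  · exact absurd h (encT_lt_encT lam' mu' t s hl).ne
  · obtain ⟨e, ν, γ⟩ := t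
    obtain ⟨e', ν', γ'⟩ := s
    simp only at hl
    subst hl
    simp only [encT, add_assoc, Nat.add_left_cancel_iff] at h
    have h1 := congrArg (· / (lam' e + 1)) h
    have h2 := congrArg (· % (lam' e + 1)) h
    simp only [mul_comm (_ : ℕ) (lam' e + 1), Nat.mul_add_mod,
      Nat.mul_add_div (Nat.succ_pos (lam' e)), Nat.mod_eq_of_lt γ.2, Nat.mod_eq_of_lt γ'.2,
      Nat.div_eq_of_lt γ.2, Nat.div_eq_of_lt γ'.2, add_zero] at h1 h2
    rw [Fin.ext h1, Fin.ext h2]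
  · exact absurd h (encT_lt_encT lam' mu' s t hl).ne'

lemma card_triple {d : ℕ} (lam' mu' : Fin d → ℕ) :
    Fintype.card (Triple d lam' mu') = ∑ e, (mu' e + 1) * (lam' e + 1) := by
  simp [Triple]

/-- The lexicographic identification -/
noncomputable def encE {d κ : ℕ} (lam' mu' : Fin d → ℕ)
    (h : ∑ e, (mu' e + 1) * (lam' e + 1) = κ) : Triple d lam' mu' ≃ Fin κ :=
  Equiv.ofBijective (fun t => (⟨encT lam' mu' t, encT_lt lam' mu' t h⟩ : Fin κ))
    ((Fintype.bijective_iff_injective_and_card _).2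
      ⟨fun t s hts => encT_inj lam' mu' (Fin.mk.inj_iff.1 hts), by
        rw [card_triple, h, Fintype.card_fin]⟩)

/-- block of the bijection `ψ` -/
def blk {d κ : ℕ} {lam' mu' : Fin d → ℕ} (ψ : Triple d lam' mu' ≃ Fin κ)
    (p : (e : Fin d) × Fin (mu' e + 1)) : Finset (Fin κ) :=
  Finset.univ.image (fun γ : Fin (lam' p.1 + 1) => ψ ⟨p.1, (p.2, γ)⟩)

def prts {d κ : ℕ} {lam' mu' : Fin d → ℕ} (ψ : Triple d lam' mu' ≃ Fin κ) :
    Finset (Finset (Fin κ)) := Finset.univ.image (blk ψ)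

section
variable {d κ : ℕ} {lam' mu' : Fin d → ℕ} (ψ : Triple d lam' mu' ≃ Fin κ)

lemma mem_blk (p : (e : Fin d) × Fin (mu' e + 1)) (a : Fin κ) :
    a ∈ blk ψ p ↔ ∃ γ, ψ ⟨p.1, (p.2, γ)⟩ = a := by simp [blk]

lemma blk_mem (p : (e : Fin d) × Fin (mu' e + 1)) : blk ψ p ∈ prts ψ :=
  Finset.mem_image_of_mem _ (Finset.mem_univ _)

lemma row_inj (p : (e : Fin d) × Fin (mu' e + 1)) :
    Function.Injective (fun γ : Fin (lam' p.1 + 1) => ψ ⟨p.1, (p.2, γ)⟩) := by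
  intro a b h
  simpa using h

lemma blk_card (p : (e : Fin d) × Fin (mu' e + 1)) : (blk ψ p).card = lam' p.1 + 1 := by
  rw [blk, Finset.card_image_of_injective _ (row_inj ψ p)]; simp

lemma blk_inter (p q : (e : Fin d) × Fin (mu' e + 1)) (a : Fin κ) (hp : a ∈ blk ψ p)
    (hq : a ∈ blk ψ q) : p = q := by
  obtain ⟨γ, hγ⟩ := (mem_blk ψ p a).1 hp
  obtain ⟨γ', hγ'⟩ := (mem_blk ψ q a).1 hq
  have := ψ.injective (hγ.trans hγ'.symm)
  obtain ⟨e, ν⟩ := p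
  obtain ⟨e', ν'⟩ := q
  simp only [Sigma.mk.inj_iff] at this
  obtain ⟨rfl, h⟩ := this
  simp only [heq_eq_eq, Prod.mk.injEq] at h
  rw [h.1]

lemma blk_nonempty (p : (e : Fin d) × Fin (mu' e + 1)) : (blk ψ p).Nonempty :=
  ⟨_, (mem_blk ψ p _).2 ⟨0, rfl⟩⟩

lemma blk_inj : Function.Injective (blk ψ) := by
  intro p q h
  obtain ⟨a, ha⟩ := blk_nonempty ψ p
  exact blk_inter ψ p q a ha (h ▸ ha)

lemma prts_isPart : IsPart (prts ψ) := by
  refine ⟨?_, ?_, ?_⟩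
  · intro B hB
    obtain ⟨p, -, rfl⟩ := Finset.mem_image.1 hB
    exact blk_nonempty ψ p
  · intro B hB C hC a ha ha'
    obtain ⟨p, -, rfl⟩ := Finset.mem_image.1 hB
    obtain ⟨q, -, rfl⟩ := Finset.mem_image.1 hC
    rw [blk_inter ψ p q a ha ha']
  · intro a
    refine ⟨_, blk_mem ψ ⟨(ψ.symm a).1, (ψ.symm a).2.1⟩, (mem_blk ψ _ _).2 ⟨(ψ.symm a).2.2, ?_⟩⟩
    exact ψ.apply_symm_apply a

lemma prts_card : (prts ψ).card = ∑ e, (mu' e + 1) := by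
  rw [prts, Finset.card_image_of_injective _ (blk_inj ψ)]; simp

lemma prts_prod (F : Finset (Fin κ) → ℝ) :
    ∏ B ∈ prts ψ, F B = ∏ e, ∏ ν, F (blk ψ ⟨e, ν⟩) := by
  rw [prts, Finset.prod_image (fun a _ b _ h => blk_inj ψ h), Fintype.prod_sigma]

lemma prts_sizes : (prts ψ).image Finset.card = Finset.univ.image (fun e => lam' e + 1) := by
  ext s
  simp only [prts, Finset.mem_image, Finset.mem_univ, true_and, exists_exists_eq_and, blk_card]
  exact ⟨fun ⟨p, hp⟩ => ⟨p.1, hp⟩, fun ⟨e, he⟩ => ⟨⟨e, 0⟩, he⟩⟩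

lemma prts_mult (hl : Function.Injective lam') (e : Fin d) :
    ((prts ψ).filter (fun B => B.card = lam' e + 1)).card = mu' e + 1 := by
  have : (prts ψ).filter (fun B => B.card = lam' e + 1) =
      Finset.univ.image (fun ν : Fin (mu' e + 1) => blk ψ ⟨e, ν⟩) := by
    ext B
    simp only [prts, Finset.mem_filter, Finset.mem_image, Finset.mem_univ, true_and]
    constructor
    · rintro ⟨⟨⟨e', ν⟩, rfl⟩, h⟩
      rw [blk_card] at h
      have : e' = e := hl (by simpa using h)
      subst this
      exact ⟨ν, rfl⟩
    · rintro ⟨ν, rfl⟩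
      exact ⟨⟨_, rfl⟩, blk_card ψ _⟩
  rw [this, Finset.card_image_of_injective]
  · simp
  · intro a b h
    simpa using blk_inj ψ h

end

lemma prts_subset_of_inH {d κ : ℕ} {lam' mu' : Fin d → ℕ} (E : Triple d lam' mu' ≃ Fin κ)
    (σ ρ : Equiv.Perm (Triple d lam' mu')) (h : inH lam' mu' (σ⁻¹ * ρ)) :
    prts (ρ.trans E) = prts (σ.trans E) := by
  refine (prts_isPart _).eq_of_subset (prts_isPart _) fun B hB => ?_
  obtain ⟨⟨e, ν⟩, -, rfl⟩ := Finset.mem_image.1 hB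
  set t := (σ⁻¹ * ρ) ⟨e, (ν, 0)⟩ with ht
  have he : t.1 = e := (h e ν 0 0).1
  have key : blk (ρ.trans E) ⟨e, ν⟩ = blk (σ.trans E) ⟨t.1, t.2.1⟩ := by
    apply Finset.eq_of_subset_of_card_le
    · intro a ha
      obtain ⟨γ, rfl⟩ := (mem_blk _ _ _).1 ha
      have h1 := (h e ν γ 0).1
      have h2 := (h e ν γ 0).2
      rw [← ht] at h2
      have h3 : ρ ⟨e, (ν, γ)⟩ = σ ((σ⁻¹ * ρ) ⟨e, (ν, γ)⟩) := by simp
      generalize (σ⁻¹ * ρ) ⟨e, (ν, γ)⟩ = s at h1 h2 h3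
      rw [mem_blk]
      clear_value t
      obtain ⟨e1, ν1, γ1⟩ := t
      obtain ⟨e2, ν2, γ2⟩ := s
      simp only at he h1
      subst h1
      subst he
      have : ν2 = ν1 := Fin.ext h2
      subst this
      exact ⟨γ2, by simp only [Equiv.trans_apply]; rw [h3]⟩
    · rw [blk_card, blk_card]; simp only [he]; exact le_rfl
  rw [key]
  exact blk_mem _ _

lemma inH_of_prts {d κ : ℕ} {lam' mu' : Fin d → ℕ} (hl : Function.Injective lam')
    (E : Triple d lam' mu' ≃ Fin κ)
    (σ ρ : Equiv.Perm (Triple d lam' mu')) (h : prts (ρ.trans E) = prts (σ.trans E)) :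
    inH lam' mu' (σ⁻¹ * ρ) := by
  have key : ∀ e ν, ∃ ν' : Fin (mu' e + 1), ∀ γ, ∃ γ' : Fin (lam' e + 1),
      (σ⁻¹ * ρ) ⟨e, (ν, γ)⟩ = ⟨e, (ν', γ')⟩ := by
    intro e ν
    have hm := blk_mem (ρ.trans E) ⟨e, ν⟩
    rw [h] at hm
    obtain ⟨⟨e', ν'⟩, -, hb⟩ := Finset.mem_image.1 hm
    have hc := congrArg Finset.card hb
    rw [blk_card, blk_card] at hc
    have : e' = e := hl (by simpa using hc)
    subst this
    refine ⟨ν', fun γ => ?_⟩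
    have ha : (ρ.trans E) ⟨e', (ν, γ)⟩ ∈ blk (σ.trans E) ⟨e', ν'⟩ := by
      rw [hb]; exact (mem_blk _ _ _).2 ⟨γ, rfl⟩
    obtain ⟨γ', hγ'⟩ := (mem_blk _ _ _).1 ha
    refine ⟨γ', ?_⟩
    have := E.injective hγ'
    simp only at this
    rw [Equiv.Perm.mul_apply, ← this]
    simp
  intro e ν γ γ'
  obtain ⟨ν', hν⟩ := key e ν
  obtain ⟨a, ha⟩ := hν γ
  obtain ⟨b, hb⟩ := hν γ'
  rw [ha, hb]
  exact ⟨rfl, rfl⟩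

lemma prts_data_inj {d d' κ : ℕ} {lam' mu' : Fin d → ℕ} {lam'' mu'' : Fin d' → ℕ}
    (ψ : Triple d lam' mu' ≃ Fin κ) (ψ' : Triple d' lam'' mu'' ≃ Fin κ)
    (hl : StrictMono lam') (hl' : StrictMono lam'') (h : prts ψ = prts ψ') :
    d = d' ∧ lam' ≍ lam'' ∧ mu' ≍ mu'' := by
  have hs := prts_sizes ψ
  rw [h, prts_sizes ψ'] at hs
  have hl1 : StrictMono (fun e => lam' e + 1) := fun a b hab => Nat.succ_lt_succ (hl hab)
  have hl1' : StrictMono (fun e => lam'' e + 1) := fun a b hab => Nat.succ_lt_succ (hl' hab)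
  have hd : d = d' := by
    have := congrArg Finset.card hs
    rw [Finset.card_image_of_injective _ hl1.injective,
      Finset.card_image_of_injective _ hl1'.injective] at this
    simpa using this.symm
  subst hd
  have hlam : (fun e => lam' e + 1) = fun e => lam'' e + 1 := by
    rw [← hl1.range_inj hl1']
    have := congrArg (fun s : Finset ℕ => (s : Set ℕ)) hs
    simpa using this.symm
  have hlam' : lam' = lam'' := funext fun e => Nat.succ_injective (congrFun hlam e)
  subst hlam'
  have hmu : mu' = mu'' := by
    funext e
    have h1 := prts_mult ψ hl.injective e
    rw [h, prts_mult ψ' hl'.injective e] at h1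
    omega
  subst hmu
  exact ⟨rfl, HEq.rfl, HEq.rfl⟩

lemma exists_data {κ : ℕ} (hκ : 0 < κ) (P : Finset (Finset (Fin κ))) (hP : IsPart P) :
    ∃ (dm1 : ℕ) (lam' mu' : Fin (dm1 + 1) → ℕ) (ψ : Triple (dm1 + 1) lam' mu' ≃ Fin κ),
      StrictMono lam' ∧ prts ψ = P := by
  classical
  obtain ⟨B0, hB0, -⟩ := hP.2.2 ⟨0, hκ⟩
  set L : Finset ℕ := P.image Finset.card with hL
  have hLpos : 0 < L.card := Finset.card_pos.2 ⟨_, Finset.mem_image_of_mem _ hB0⟩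
  obtain ⟨dm1, hd⟩ : ∃ k, L.card = k + 1 := ⟨L.card - 1, by omega⟩
  have hmem : ∀ e, ∃ B ∈ P, B.card = L.orderEmbOfFin hd e := fun e =>
    Finset.mem_image.1 (Finset.orderEmbOfFin_mem L hd e)
  have hlp : ∀ e, ∃ k, L.orderEmbOfFin hd e = k + 1 := by
    intro e
    obtain ⟨B, hB, hc⟩ := hmem e
    have := Finset.card_pos.2 (hP.1 B hB)
    exact ⟨L.orderEmbOfFin hd e - 1, by omega⟩
  choose lam' hlam using hlp
  have hmp : ∀ e, ∃ k, (P.filter (fun B => B.card = lam' e + 1)).card = k + 1 := by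
    intro e
    obtain ⟨B, hB, hc⟩ := hmem e
    have : 0 < (P.filter (fun B => B.card = lam' e + 1)).card :=
      Finset.card_pos.2 ⟨B, Finset.mem_filter.2 ⟨hB, hc.trans (hlam e)⟩⟩
    exact ⟨_, (Nat.sub_add_cancel this).symm⟩
  choose mu' hmu using hmp
  have hsm : StrictMono lam' := by
    intro a b hab
    have := (L.orderEmbOfFin hd).strictMono hab
    rw [hlam, hlam] at this
    omega
  let b : ∀ e, Fin (mu' e + 1) ≃ P.filter (fun B => B.card = lam' e + 1) := fun e =>
    (Finset.equivFinOfCardEq (hmu e)).symm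
  have hbP : ∀ e ν, (b e ν : Finset (Fin κ)) ∈ P := fun e ν => (Finset.mem_filter.1 (b e ν).2).1
  have hbc : ∀ e ν, (b e ν : Finset (Fin κ)).card = lam' e + 1 :=
    fun e ν => (Finset.mem_filter.1 (b e ν).2).2
  let w : ∀ e ν, Fin (lam' e + 1) ≃ (b e ν : Finset (Fin κ)) := fun e ν =>
    (Finset.equivFinOfCardEq (hbc e ν)).symm
  let ψ : Triple (dm1 + 1) lam' mu' → Fin κ := fun t => w t.1 t.2.1 t.2.2
  have hψ : Function.Bijective ψ := by
    constructor
    · rintro ⟨e, ν, γ⟩ ⟨e', ν', γ'⟩ h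
      simp only [ψ] at h
      have h1 : (b e ν : Finset (Fin κ)) = b e' ν' :=
        hP.2.1 _ (hbP e ν) _ (hbP e' ν') _ (w e ν γ).2 (h ▸ (w e' ν' γ').2)
      have h2 := hbc e ν
      rw [h1, hbc] at h2
      have : e' = e := hsm.injective (by omega)
      subst this
      have : ν = ν' := (b e').injective (Subtype.ext h1)
      subst this
      have : γ = γ' := (w e' ν).injective (Subtype.ext h)
      subst this
      rfl
    · intro a
      obtain ⟨B, hB, ha⟩ := hP.2.2 a
      have : B.card ∈ Set.range (L.orderEmbOfFin hd) := by
        rw [Finset.range_orderEmbOfFin]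
        exact Finset.mem_coe.2 (Finset.mem_image_of_mem _ hB)
      obtain ⟨e, he⟩ := this
      rw [hlam] at he
      obtain ⟨ν, hν⟩ := (b e).surjective ⟨B, Finset.mem_filter.2 ⟨hB, he.symm⟩⟩
      have ha' : a ∈ (b e ν : Finset (Fin κ)) := by rw [hν]; exact ha
      obtain ⟨γ, hγ⟩ := (w e ν).surjective ⟨a, ha'⟩
      exact ⟨⟨e, (ν, γ)⟩, by simp only [ψ]; rw [hγ]⟩
  refine ⟨dm1, lam', mu', Equiv.ofBijective ψ hψ, hsm, ?_⟩
  refine (prts_isPart _).eq_of_subset hP fun B hB => ?_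
  obtain ⟨⟨e, ν⟩, -, rfl⟩ := Finset.mem_image.1 hB
  have : blk (Equiv.ofBijective ψ hψ) ⟨e, ν⟩ = (b e ν : Finset (Fin κ)) := by
    apply Finset.eq_of_subset_of_card_le
    · intro a ha
      obtain ⟨γ, rfl⟩ := (mem_blk _ _ _).1 ha
      exact (w e ν γ).2
    · rw [blk_card, hbc]
  rw [this]
  exact hbP e ν

lemma bound_data {d κ : ℕ} (lam' mu' : Fin d → ℕ)
    (h : ∑ e, (mu' e + 1) * (lam' e + 1) = κ) (e : Fin d) : lam' e < κ ∧ mu' e < κ := by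
  have h1 := Finset.single_le_sum (f := fun e => (mu' e + 1) * (lam' e + 1))
    (fun _ _ => Nat.zero_le _) (Finset.mem_univ e)
  rw [h] at h1
  constructor <;> nlinarith [Nat.zero_le (lam' e * mu' e)]

lemma bound_d {d κ : ℕ} (lam' mu' : Fin d → ℕ)
    (h : ∑ e, (mu' e + 1) * (lam' e + 1) = κ) : d ≤ κ := by
  rw [← h]
  calc d = ∑ _e : Fin d, 1 := by simp
    _ ≤ _ := Finset.sum_le_sum fun e _ => Nat.mul_pos (Nat.succ_pos _) (Nat.succ_pos _)

/-- The multivariate Faà di Bruno formula for `h(x) = f(g(x))`, `g : ℝⁿ → ℝ`, `f : ℝ → ℝ`,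
for an arbitrary choice `R` of complete sets of representatives of the left cosets
`S_κ / H`. -/
theorem faa_di_bruno_several_independent_variables
    (n : ℕ) (hn : 0 < n) (g : (Fin n → ℝ) → ℝ) (f : ℝ → ℝ)
    (hg : ContDiff ℝ (⊤ : ℕ∞) g) (hf : ContDiff ℝ (⊤ : ℕ∞) f)
    (κ : ℕ) (hκ : 0 < κ) (i : Fin κ → Fin n)
    (R : ∀ (d : ℕ) (lam' mu' : Fin d → ℕ), Finset (Equiv.Perm (Triple d lam' mu')))
    (hR : ∀ (d : ℕ) (lam' mu' : Fin d → ℕ) (σ : Equiv.Perm (Triple d lam' mu')),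
      ∃! ρ, ρ ∈ R d lam' mu' ∧ inH lam' mu' (σ⁻¹ * ρ))
    (x : Fin n → ℝ) :
    pdl (List.ofFn i) (fun z => f (g z)) x =
      ∑ dm1 ∈ Finset.range κ,
        ∑ lam' ∈ (Fintype.piFinset fun _ : Fin (dm1 + 1) => Finset.range κ).filter
            (fun lam' => ∀ a b : Fin (dm1 + 1), a < b → lam' a < lam' b),
        ∑ mu' ∈ (Fintype.piFinset fun _ : Fin (dm1 + 1) => Finset.range κ).filter
            (fun mu' => ∑ e, (mu' e + 1) * (lam' e + 1) = κ),
          iteratedDeriv (∑ e, (mu' e + 1)) f (g x)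
            * ∑ σ ∈ R (dm1 + 1) lam' mu',
                ∏ e : Fin (dm1 + 1), ∏ ν : Fin (mu' e + 1),
                  pdl (List.ofFn (fun γ : Fin (lam' e + 1) =>
                      if h : encT lam' mu' (σ ⟨e, (ν, γ)⟩) < κ
                      then i ⟨encT lam' mu' (σ ⟨e, (ν, γ)⟩), h⟩
                      else i ⟨0, hκ⟩))
                    g x := by
  classical
  rw [lhs_eq' g f hg hf]
  simp only [Finset.mul_sum]
  simp only [Finset.sum_sigma']
  symm
  have conv : ∀ (d : ℕ) (lam' mu' : Fin d → ℕ) (h : ∑ e, (mu' e + 1) * (lam' e + 1) = κ)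
      (σ : Equiv.Perm (Triple d lam' mu')),
      ∏ e : Fin d, ∏ ν : Fin (mu' e + 1),
                  pdl (List.ofFn (fun γ : Fin (lam' e + 1) =>
                      if h : encT lam' mu' (σ ⟨e, (ν, γ)⟩) < κ
                      then i ⟨encT lam' mu' (σ ⟨e, (ν, γ)⟩), h⟩
                      else i ⟨0, hκ⟩))
                    g x = ∏ B ∈ prts (σ.trans (encE lam' mu' h)), Dblk g i x B := by
    intro d lam' mu' h σ
    rw [prts_prod]
    refine Finset.prod_congr rfl fun e _ => Finset.prod_congr rfl fun ν _ => ?_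
    rw [blk, ← pdl_eq_Dblk g hg i x _ (row_inj (σ.trans (encE lam' mu' h)) ⟨e, ν⟩)]
    congr 2
    funext γ
    rw [dif_pos (encT_lt lam' mu' _ h)]
    rfl
  refine Finset.sum_bij (fun a ha => prts ((a.2.2.2 : Equiv.Perm _).trans
    (encE (κ := κ) a.2.1 a.2.2.1 ?_))) ?_ ?_ ?_ ?_
  · simp only [Finset.mem_sigma, Finset.mem_filter] at ha
    exact ha.2.2.1.2
  · intro a ha
    simpa using prts_isPart _
  · rintro ⟨d, lam', mu', σ⟩ ha ⟨d', lam'', mu'', ρ⟩ hb h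
    simp only [Finset.mem_sigma, Finset.mem_filter] at ha hb
    have hl : StrictMono lam' := fun a b hab => ha.2.1.2 a b hab
    have hl' : StrictMono lam'' := fun a b hab => hb.2.1.2 a b hab
    obtain ⟨h1, h2, h3⟩ := prts_data_inj _ _ hl hl' h
    have h1 : d = d' := by omega
    subst h1
    have h2 := eq_of_heq h2
    subst h2
    have h3 := eq_of_heq h3
    subst h3
    have hH := inH_of_prts hl.injective _ ρ σ h
    have hH' : inH lam' mu' (ρ⁻¹ * ρ) := inH_of_prts hl.injective (encE lam' mu' ha.2.2.1.2) ρ ρ rfl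
    have := (hR _ lam' mu' ρ).unique ⟨ha.2.2.2, hH⟩ ⟨hb.2.2.2, hH'⟩
    rw [this]
  · intro P hP
    obtain ⟨d, lam', mu', ψ, hsm, hψ⟩ := exists_data hκ P (Finset.mem_filter.1 hP).2
    have hs : ∑ e, (mu' e + 1) * (lam' e + 1) = κ := by
      rw [← card_triple, Fintype.card_congr ψ, Fintype.card_fin]
    obtain ⟨ρ, ⟨hρ, hρH⟩, -⟩ := hR _ lam' mu' (ψ.trans (encE lam' mu' hs).symm)
    refine ⟨⟨d, lam', mu', ρ⟩, ?_, ?_⟩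
    · simp only [Finset.mem_sigma, Finset.mem_filter, Fintype.mem_piFinset, Finset.mem_range]
      exact ⟨bound_d lam' mu' hs, ⟨fun e => (bound_data lam' mu' hs e).1, fun a b hab => hsm hab⟩,
        ⟨fun e => (bound_data lam' mu' hs e).2, hs⟩, hρ⟩
    · rw [← hψ]
      refine (prts_subset_of_inH (encE lam' mu' hs) _ ρ hρH).trans ?_
      congr 1
      ext t
      simp
  · rintro ⟨d, lam', mu', σ⟩ ha
    simp only [Finset.mem_sigma, Finset.mem_filter] at ha
    rw [prts_card]
    exact congrArg _ (conv _ lam' mu' ha.2.2.1.2 σ)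
end

section
/- For every j ∈ {1,…,m} and every integer κ ≥ 1, the prolongation coefficient 𝐘_κ^j is given by the closed formula: 𝐘_κ^j = 𝒴^j_{x^κ} + Σ_{d=1}^{κ+1} Σ_{1≤λ_1<⋯<λ_d≤κ} Σ_{μ_1≥1,…,μ_d≥1 with N := μ_1λ_1+⋯+μ_dλ_d ≤ κ+1} Σ_{l_{1:1},…,l_{1:μ_1},…,l_{d:1},…,l_{d:μ_d} = 1}^{m} ( κ(κ−1)⋯(κ−N+2) / ((λ_1!)^{μ_1} μ_1! ⋯ (λ_d!)^{μ_d} μ_d!) ) · [ (κ−N+1) · ∂^{κ−N+μ_1+⋯+μ_d}𝒴^j / ((∂x)^{κ−N} ∂y^{l_{1:1}} ⋯ ∂y^{l_{1:μ_1}} ⋯ ∂y^{l_{d:1}} ⋯ ∂y^{l_{d:μ_d}}) − Σ_{e=1}^{d} δ^j_{l_{e:1}} · μ_e λ_e · ∂^{κ−N+μ_1+⋯+μ_d}𝒳 / ((∂x)^{κ−N+1} ∂y^{l_{1:1}} ⋯ ∂y^{l_{d:μ_d}} with the factor ∂y^{l_{e:1}} omitted) ] · Π_{e=1}^{d} Π_{ν=1}^{μ_e}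 y_{λ_e}^{l_{e:ν}}, where κ(κ−1)⋯(κ−N+2) denotes the falling factorial κ!/(κ−N+1)!. -/
/-- Kronecker symbol `δ_a^b` as a real number. -/
def kron {α : Type*} [DecidableEq α] (a b : α) : ℝ := if a = b then 1 else 0

/-- Partial derivative of `F(x,y)`, `x ∈ ℝ`, `y ∈ ℝᵐ`, with respect to `y^l`. -/
noncomputable def pdyM {m : ℕ} (l : Fin m) (F : ℝ → (Fin m → ℝ) → ℝ) :
    ℝ → (Fin m → ℝ) → ℝ :=
  fun x y => deriv (fun t => F x (Function.update y l t)) (y l)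

/-- Iterated partial derivative with respect to the `y`-coordinates listed in `ys`. -/
noncomputable def pdylM {m : ℕ} : List (Fin m) → (ℝ → (Fin m → ℝ) → ℝ) →
    (ℝ → (Fin m → ℝ) → ℝ)
  | [], F => F
  | a :: ls, F => pdyM a (pdylM ls F)

/-- Partial derivative with respect to `x`. -/
noncomputable def pdxM {m : ℕ} (F : ℝ → (Fin m → ℝ) → ℝ) : ℝ → (Fin m → ℝ) → ℝ :=
  fun x y => deriv (fun t => F t y) x

/-- Mixed partial derivative `∂^{a+|ys|} F / (∂x)^a ∂y^{ys}`. -/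
noncomputable def pdM {m : ℕ} (a : ℕ) (ys : List (Fin m))
    (F : ℝ → (Fin m → ℝ) → ℝ) : ℝ → (Fin m → ℝ) → ℝ := pdxM^[a] (pdylM ys F)

/-- The total differentiation operator `D^λ` for one independent variable and `m`
dependent variables.  The state is `(x, P)` where `P (l, 0)` is the dependent variable
`y^l` and `P (l, c)` (`c ≥ 1`) is the jet variable `y_c^l`. -/
noncomputable def totalDm {m : ℕ} (lam : ℕ) (F : ℝ → (Fin m × ℕ → ℝ) → ℝ) :
    ℝ → (Fin m × ℕ → ℝ) → ℝ :=
  fun x P => deriv (fun t => F t P) x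
    + ∑ l : Fin m, ∑ c ∈ Finset.range lam,
        P (l, c + 1) * deriv (fun t => F x (Function.update P (l, c) t)) (P (l, c))

/-- The prolongation coefficients `𝐘_λ^j`:  `prolongM X Y j 0 = 𝒴^j` and
`𝐘^j_{λ+1} = D^{λ+1}(𝐘^j_λ) − D¹(𝒳)·y^j_{λ+1}`. -/
noncomputable def prolongM {m : ℕ} (X : ℝ → (Fin m → ℝ) → ℝ)
    (Y : Fin m → ℝ → (Fin m → ℝ) → ℝ) (j : Fin m) : ℕ → ℝ → (Fin m × ℕ → ℝ) → ℝ
  | 0 => fun x P => Y j x (fun l => P (l, 0))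
  | lam + 1 => fun x P =>
      totalDm (lam + 1) (prolongM X Y j lam) x P
        - totalDm 1 (fun x' P' => X x' (fun l => P' (l, 0))) x P * P (j, lam + 1)

/-- The list of the dependent-variable indices `l_{1:1},…,l_{1:μ_1},…,l_{d:1},…,l_{d:μ_d}`
in lexicographic order (block data shifted by one: family `e` has `mu' e + 1` blocks). -/
def blkList {m d : ℕ} {mu' : Fin d → ℕ} (l : ((e : Fin d) × Fin (mu' e + 1)) → Fin m) :
    List (Fin m) :=
  ((List.finRange d).map (fun e => List.ofFn (fun ν : Fin (mu' e + 1) => l ⟨e, ν⟩))).flatten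

/-- Same list with the entry `l_{e₀:1}` omitted. -/
def blkListDrop {m d : ℕ} {mu' : Fin d → ℕ} (l : ((e : Fin d) × Fin (mu' e + 1)) → Fin m)
    (e₀ : Fin d) : List (Fin m) :=
  ((List.finRange d).map (fun e =>
    (List.ofFn (fun ν : Fin (mu' e + 1) => l ⟨e, ν⟩)).drop (if e = e₀ then 1 else 0))).flatten

section Helpers

open MvPolynomial


/-- smoothness of a curried function -/
def SmM {m : ℕ} (F : ℝ → (Fin m → ℝ) → ℝ) : Prop :=
  ContDiff ℝ (⊤ : ℕ∞) (fun p : ℝ × (Fin m → ℝ) => F p.1 p.2)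

theorem SmM.hasDeriv_x {m : ℕ} {F : ℝ → (Fin m → ℝ) → ℝ} (h : SmM F) (x : ℝ) (y : Fin m → ℝ) :
    HasDerivAt (fun t => F t y)
      (fderiv ℝ (fun p : ℝ × (Fin m → ℝ) => F p.1 p.2) (x, y) (1, 0)) x := by
  have h1 : HasFDerivAt (fun p : ℝ × (Fin m → ℝ) => F p.1 p.2) _ (x, y) :=
    (h.differentiable (by simp) (x, y)).hasFDerivAt
  have h2 : HasDerivAt (fun t : ℝ => (t, y)) ((1 : ℝ), (0 : Fin m → ℝ)) x :=
    (hasDerivAt_id x).prodMk (hasDerivAt_const x y)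
  exact h1.comp_hasDerivAt x h2

theorem SmM.hasDeriv_y {m : ℕ} {F : ℝ → (Fin m → ℝ) → ℝ} (h : SmM F) (x : ℝ) (y : Fin m → ℝ)
    (l : Fin m) :
    HasDerivAt (fun t => F x (Function.update y l t))
      (fderiv ℝ (fun p : ℝ × (Fin m → ℝ) => F p.1 p.2) (x, y) (0, Pi.single l 1)) (y l) := by
  have h1 : HasFDerivAt (fun p : ℝ × (Fin m → ℝ) => F p.1 p.2)
      (fderiv ℝ (fun p : ℝ × (Fin m → ℝ) => F p.1 p.2) (x, y)) (x, Function.update y l (y l)) := by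
    rw [Function.update_eq_self]
    exact (h.differentiable (by simp) (x, y)).hasFDerivAt
  have h2 : HasDerivAt (fun t : ℝ => (x, Function.update y l t))
      ((0 : ℝ), (Pi.single l 1 : Fin m → ℝ)) (y l) :=
    (hasDerivAt_const _ x).prodMk (hasDerivAt_update y l (y l))
  exact h1.comp_hasDerivAt (y l) h2

theorem SmM.pdx_eq {m : ℕ} {F : ℝ → (Fin m → ℝ) → ℝ} (h : SmM F) :
    (fun p : ℝ × (Fin m → ℝ) => pdxM F p.1 p.2) =
      fun p => fderiv ℝ (fun p : ℝ × (Fin m → ℝ) => F p.1 p.2) p (1, 0) := by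
  funext p
  exact (h.hasDeriv_x p.1 p.2).deriv

theorem SmM.pdy_eq {m : ℕ} {F : ℝ → (Fin m → ℝ) → ℝ} (h : SmM F) (l : Fin m) :
    (fun p : ℝ × (Fin m → ℝ) => pdyM l F p.1 p.2) =
      fun p => fderiv ℝ (fun p : ℝ × (Fin m → ℝ) => F p.1 p.2) p (0, Pi.single l 1) := by
  funext p
  exact (h.hasDeriv_y p.1 p.2 l).deriv

theorem smooth_dir {E : Type*} [NormedAddCommGroup E] [NormedSpace ℝ E] {G : E → ℝ}
    (h : ContDiff ℝ (⊤ : ℕ∞) G) (v : E) : ContDiff ℝ (⊤ : ℕ∞) (fun p => fderiv ℝ G p v) :=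
  (h.fderiv_right (m := (⊤ : ℕ∞)) (by simp)).clm_apply contDiff_const

theorem dir_comm {E : Type*} [NormedAddCommGroup E] [NormedSpace ℝ E] {G : E → ℝ}
    (h : ContDiff ℝ (⊤ : ℕ∞) G) (v w : E) (p : E) :
    fderiv ℝ (fun q => fderiv ℝ G q v) p w = fderiv ℝ (fun q => fderiv ℝ G q w) p v := by
  have hd : DifferentiableAt ℝ (fderiv ℝ G) p :=
    (h.fderiv_right (m := (⊤ : ℕ∞)) (by simp)).differentiable (by simp) p
  have hs : IsSymmSndFDerivAt ℝ G p :=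
    h.contDiffAt.isSymmSndFDerivAt (by
      rw [minSmoothness_of_isRCLikeNormedField]
      exact WithTop.coe_le_coe.2 (le_top : (2 : ℕ∞) ≤ ⊤))
  rw [fderiv_clm_apply hd (by fun_prop), fderiv_clm_apply hd (by fun_prop)]
  simp
  exact hs w v

theorem SmM.pdx {m : ℕ} {F : ℝ → (Fin m → ℝ) → ℝ} (h : SmM F) : SmM (pdxM F) := by
  unfold SmM; rw [h.pdx_eq]; exact smooth_dir h _

theorem SmM.pdy {m : ℕ} {F : ℝ → (Fin m → ℝ) → ℝ} (h : SmM F) (l : Fin m) : SmM (pdyM l F) := by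
  unfold SmM; rw [h.pdy_eq]; exact smooth_dir h _

theorem SmM.pdyx_comm {m : ℕ} {F : ℝ → (Fin m → ℝ) → ℝ} (h : SmM F) (l : Fin m) :
    pdyM l (pdxM F) = pdxM (pdyM l F) := by
  funext x y
  have h1 := congrFun (h.pdx.pdy_eq l) (x, y)
  have h2 := congrFun ((h.pdy l).pdx_eq) (x, y)
  rw [h.pdx_eq] at h1
  rw [h.pdy_eq] at h2
  simp only at h1 h2
  rw [h1, h2]
  exact dir_comm h _ _ _

theorem SmM.pdyy_comm {m : ℕ} {F : ℝ → (Fin m → ℝ) → ℝ} (h : SmM F) (l l' : Fin m) :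
    pdyM l (pdyM l' F) = pdyM l' (pdyM l F) := by
  funext x y
  have h1 := congrFun ((h.pdy l').pdy_eq l) (x, y)
  have h2 := congrFun ((h.pdy l).pdy_eq l') (x, y)
  rw [h.pdy_eq] at h1 h2
  simp only at h1 h2
  rw [h1, h2]
  exact dir_comm h _ _ _

theorem SmM.pdyl {m : ℕ} {F : ℝ → (Fin m → ℝ) → ℝ} (h : SmM F) (ls : List (Fin m)) :
    SmM (pdylM ls F) := by
  induction ls with
  | nil => exact h
  | cons a ls ih => exact ih.pdy a

theorem SmM.pdx_iter {m : ℕ} {F : ℝ → (Fin m → ℝ) → ℝ} (h : SmM F) (a : ℕ) :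
    SmM (pdxM^[a] F) := by
  induction a with
  | zero => exact h
  | succ a ih => rw [Function.iterate_succ_apply']; exact ih.pdx

theorem SmM.pdy_iter_comm {m : ℕ} {F : ℝ → (Fin m → ℝ) → ℝ} (h : SmM F) (l : Fin m) (a : ℕ) :
    pdyM l (pdxM^[a] F) = pdxM^[a] (pdyM l F) := by
  induction a with
  | zero => rfl
  | succ a ih =>
    rw [Function.iterate_succ_apply', Function.iterate_succ_apply', (h.pdx_iter a).pdyx_comm, ih]

theorem SmM.pdyl_perm {m : ℕ} {F : ℝ → (Fin m → ℝ) → ℝ} (h : SmM F) {l1 l2 : List (Fin m)}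
    (hp : l1.Perm l2) : pdylM l1 F = pdylM l2 F := by
  induction hp with
  | nil => rfl
  | cons a _ ih => simp only [pdylM]; rw [ih]
  | swap a b l => exact (h.pdyl l).pdyy_comm _ _
  | trans _ _ ih1 ih2 => exact ih1.trans ih2

theorem SmM.pd {m : ℕ} {F : ℝ → (Fin m → ℝ) → ℝ} (h : SmM F) (a : ℕ) (ls : List (Fin m)) :
    SmM (pdM a ls F) := (h.pdyl ls).pdx_iter a

/-- Constant coefficient differential operators evaluated on `F` at `(x, y)`. -/
noncomputable def opL {m : ℕ} (F : ℝ → (Fin m → ℝ) → ℝ) (x : ℝ) (y : Fin m → ℝ) :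
    MvPolynomial (Option (Fin m)) ℝ →ₗ[ℝ] ℝ :=
  (basisMonomials (Option (Fin m)) ℝ).constr ℝ
    (fun α => pdM (α none) (Finsupp.toMultiset α.some).toList F x y)

theorem opL_monomial {m : ℕ} (F : ℝ → (Fin m → ℝ) → ℝ) (x : ℝ) (y : Fin m → ℝ)
    (α : Option (Fin m) →₀ ℕ) (c : ℝ) :
    opL F x y (monomial α c) = c * pdM (α none) (Finsupp.toMultiset α.some).toList F x y := by
  have : (monomial α c : MvPolynomial (Option (Fin m)) ℝ) = c • basisMonomials _ ℝ α := by
    simp [MvPolynomial.smul_monomial]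
  rw [this, map_smul, opL, Module.Basis.constr_basis, smul_eq_mul]

theorem opL_monomial' {m : ℕ} {F : ℝ → (Fin m → ℝ) → ℝ} (h : SmM F) (x : ℝ) (y : Fin m → ℝ)
    (α : Option (Fin m) →₀ ℕ) (c : ℝ) (a : ℕ) (ls : List (Fin m)) (ha : α none = a)
    (hl : ∀ i, α (some i) = ls.count i) :
    opL F x y (monomial α c) = c * pdM a ls F x y := by
  rw [opL_monomial, ha, pdM, pdM, h.pdyl_perm (l2 := ls)]
  rw [← Multiset.coe_eq_coe, Multiset.coe_toList]
  ext i
  simp [Finsupp.count_toMultiset, hl]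

theorem opL_list {m : ℕ} {F : ℝ → (Fin m → ℝ) → ℝ} (h : SmM F) (x : ℝ) (y : Fin m → ℝ)
    (a : ℕ) (ls : List (Fin m)) :
    opL F x y (X none ^ a * (ls.map (fun l => X (some l))).prod) = pdM a ls F x y := by
  have key : ∀ ls : List (Fin m), ∃ β : Option (Fin m) →₀ ℕ, β none = 0 ∧
      (∀ i, β (some i) = ls.count i) ∧
      (ls.map (fun l => (X (some l) : MvPolynomial (Option (Fin m)) ℝ))).prod = monomial β 1 := by
    intro ls
    induction ls with
    | nil => exact ⟨0, by simp⟩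
    | cons l ls ih =>
      obtain ⟨β, h0, h1, h2⟩ := ih
      refine ⟨Finsupp.single (some l) 1 + β, by simp [h0], fun i => ?_, ?_⟩
      · simp only [Finsupp.add_apply, h1, List.count_cons, Finsupp.single_apply, Option.some_inj]
        simp [add_comm]
      · rw [List.map_cons, List.prod_cons, h2, X, monomial_mul, mul_one]
  obtain ⟨β, h0, h1, h2⟩ := key ls
  rw [h2, X_pow_eq_monomial, monomial_mul,
    opL_monomial' h x y _ _ a ls (by simp [h0]) (by simp [h1])]
  simp

theorem opL_hasDeriv_x {m : ℕ} {F : ℝ → (Fin m → ℝ) → ℝ} (h : SmM F) (x : ℝ) (y : Fin m → ℝ)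
    (r : MvPolynomial (Option (Fin m)) ℝ) :
    HasDerivAt (fun t => opL F t y r) (opL F x y (X none * r)) x := by
  induction r using MvPolynomial.induction_on' with
  | monomial α c =>
    have e : (X none * monomial α c : MvPolynomial (Option (Fin m)) ℝ)
        = monomial (Finsupp.single none 1 + α) c := by rw [X, monomial_mul, one_mul]
    rw [e, opL_monomial' h x y _ c (α none + 1) (Finsupp.toMultiset α.some).toList
      (by simp [add_comm]) (by
        intro i
        rw [← Multiset.coe_count, Multiset.coe_toList, Finsupp.count_toMultiset]
        simp)]
    simp only [opL_monomial]
    refine HasDerivAt.const_mul c ?_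
    have := ((h.pd (α none) (Finsupp.toMultiset α.some).toList).hasDeriv_x x y)
    refine this.congr_deriv (this.deriv.symm.trans ?_)
    symm
    change (pdxM^[α none + 1] _) x y = _
    rw [Function.iterate_succ_apply']
    rfl
  | add p q hp hq =>
    simp only [map_add, mul_add]
    exact hp.add hq

theorem opL_hasDeriv_y {m : ℕ} {F : ℝ → (Fin m → ℝ) → ℝ} (h : SmM F) (x : ℝ) (y : Fin m → ℝ)
    (l : Fin m) (r : MvPolynomial (Option (Fin m)) ℝ) :
    HasDerivAt (fun t => opL F x (Function.update y l t) r) (opL F x y (X (some l) * r)) (y l) := by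
  induction r using MvPolynomial.induction_on' with
  | monomial α c =>
    have e : (X (some l) * monomial α c : MvPolynomial (Option (Fin m)) ℝ)
        = monomial (Finsupp.single (some l) 1 + α) c := by rw [X, monomial_mul, one_mul]
    rw [e, opL_monomial' h x y _ c (α none) (l :: (Finsupp.toMultiset α.some).toList)
      (by simp) (by
        intro i
        rw [List.count_cons, ← Multiset.coe_count, Multiset.coe_toList, Finsupp.count_toMultiset]
        simp [Finsupp.single_apply, add_comm])]
    simp only [opL_monomial]
    refine HasDerivAt.const_mul c ?_
    have := ((h.pd (α none) (Finsupp.toMultiset α.some).toList).hasDeriv_y x y l)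
    refine this.congr_deriv (this.deriv.symm.trans ?_)
    symm
    change (pdxM^[α none] (pdyM l (pdylM _ _))) x y = _
    rw [← (h.pdyl _).pdy_iter_comm]
    rfl
  | add p q hp hq =>
    simp only [map_add, mul_add]
    exact hp.add hq

/-- images of the formal variables: `0` is `∂_x`, `c ≥ 1` is `∑ y_c^l ∂_{y^l}`. -/
noncomputable def symV {m : ℕ} (P : Fin m × ℕ → ℝ) (c : ℕ) : MvPolynomial (Option (Fin m)) ℝ :=
  if c = 0 then X none else ∑ l : Fin m, C (P (l, c)) * X (some l)

noncomputable def symPhi {m : ℕ} (P : Fin m × ℕ → ℝ) :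
    MvPolynomial ℕ ℝ →ₐ[ℝ] MvPolynomial (Option (Fin m)) ℝ := aeval (symV P)

theorem symV_update_ne {m : ℕ} (P : Fin m × ℕ → ℝ) (l : Fin m) (c i : ℕ) (h : i ≠ c) (t : ℝ) :
    symV (Function.update P (l, c) t) i = symV P i := by
  unfold symV
  split_ifs with h0
  · rfl
  · refine Finset.sum_congr rfl fun l' _ => ?_
    rw [Function.update_of_ne]
    simp [h]

theorem symV_update_self {m : ℕ} (P : Fin m × ℕ → ℝ) (l : Fin m) (c : ℕ) (h : c ≠ 0) (t : ℝ) :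
    symV (Function.update P (l, c) t) c = symV P c + C (t - P (l, c)) * X (some l) := by
  unfold symV
  rw [if_neg h, if_neg h, ← Finset.add_sum_erase _ _ (Finset.mem_univ l),
    ← Finset.add_sum_erase (Finset.univ) (fun l => C (P (l, c)) * X (some l)) (Finset.mem_univ l)]
  rw [Function.update_self, C_sub]
  have : ∑ x ∈ Finset.univ.erase l, (C (Function.update P (l, c) t (x, c)) * X (some x) :
      MvPolynomial (Option (Fin m)) ℝ) = ∑ x ∈ Finset.univ.erase l, C (P (x, c)) * X (some x) := by
    refine Finset.sum_congr rfl fun l' hl' => ?_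
    rw [Function.update_of_ne]
    simpa using (Finset.mem_erase.1 hl').1
  rw [this]; ring

theorem symPhi_update_zero {m : ℕ} (P : Fin m × ℕ → ℝ) (l : Fin m) (t : ℝ) :
    symPhi (Function.update P (l, 0) t) = symPhi P := by
  unfold symPhi
  congr 1
  funext i
  by_cases h : i = 0
  · subst h; simp [symV]
  · exact symV_update_ne P l 0 i h t

theorem symPhi_hasDeriv {m : ℕ} (P : Fin m × ℕ → ℝ) (l : Fin m) (c : ℕ) (hc : c ≠ 0)
    (Q : MvPolynomial ℕ ℝ) : ∀ (T : MvPolynomial (Option (Fin m)) ℝ →ₗ[ℝ] ℝ),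
    HasDerivAt (fun t => T (symPhi (Function.update P (l, c) t) Q))
      (T (X (some l) * symPhi P (pderiv c Q))) (P (l, c)) := by
  induction Q using MvPolynomial.induction_on with
  | C a =>
    intro T
    simp only [symPhi, aeval_C, pderiv_C, map_zero, mul_zero]
    exact hasDerivAt_const _ _
  | add p q hp hq =>
    intro T
    simp only [map_add, mul_add]
    exact (hp T).add (hq T)
  | mul_X p i ih =>
    intro T
    by_cases hi : i = c
    · subst hi
      have h1 := ih (T ∘ₗ LinearMap.mulRight ℝ (symV P i))
      have h2 := ih (T ∘ₗ LinearMap.mulRight ℝ (X (some l)))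
      have h3 := ((hasDerivAt_id (P (l, i))).sub_const (P (l, i))).mul h2
      have h4 := h1.add h3
      have e : (fun t => T (symPhi (Function.update P (l, i) t) (p * X i))) =
        ((fun t => (T ∘ₗ LinearMap.mulRight ℝ (symV P i)) (symPhi (Function.update P (l, i) t) p)) +
         ((fun t => id t - P (l, i)) * fun t =>
          (T ∘ₗ LinearMap.mulRight ℝ (X (some l))) (symPhi (Function.update P (l, i) t) p))) := by
        funext t
        have : symPhi (Function.update P (l, i) t) (X i)
          = symV P i + C (t - P (l, i)) * X (some l) := by
          rw [symPhi, aeval_X, symV_update_self P l i hc]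
        simp only [map_mul, this, Pi.add_apply, Pi.mul_apply, LinearMap.comp_apply,
          LinearMap.mulRight_apply, id]
        rw [mul_add, map_add, ← smul_eq_mul (a := t - P (l, i)), ← map_smul, smul_eq_C_mul]
        congr 2; ring
      rw [e]
      refine h4.congr_deriv ?_
      symm
      have hX : symPhi P (X i) = symV P i := by rw [symPhi, aeval_X]
      simp only [pderiv_mul, pderiv_X_self, map_add, map_mul, hX, LinearMap.comp_apply,
          LinearMap.mulRight_apply, id, sub_self, zero_mul, add_zero, one_mul, mul_add, map_one,
          mul_one, Function.update_eq_self]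
      congr 1
      · congr 1; ring
      · congr 1; ring
    · have h1 := ih (T ∘ₗ LinearMap.mulRight ℝ (symV P i))
      have hX : ∀ t, symPhi (Function.update P (l, c) t) (X i) = symV P i := fun t => by
        rw [symPhi, aeval_X, symV_update_ne P l c i hi]
      have hX' : symPhi P (X i) = symV P i := by rw [symPhi, aeval_X]
      simp only [map_mul, hX, pderiv_mul, pderiv_X_of_ne hi, mul_zero, add_zero, hX']
      simp only [LinearMap.comp_apply, LinearMap.mulRight_apply] at h1
      refine h1.congr_deriv ?_
      rw [mul_assoc]


/-- weights of the formal variables -/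
def wgt (c : ℕ) : ℕ := max 1 c

theorem wgt_pos (c : ℕ) : wgt c ≠ 0 := by unfold wgt; omega

noncomputable def wtM (k : ℕ →₀ ℕ) : ℕ := Finsupp.weight wgt k

theorem wtM_add (k k' : ℕ →₀ ℕ) : wtM (k + k') = wtM k + wtM k' := map_add _ _ _

theorem wtM_single (c e : ℕ) : wtM (Finsupp.single c e) = e * wgt c := by
  simp [wtM, Finsupp.weight_single]

theorem le_wtM (k : ℕ →₀ ℕ) (c : ℕ) : k c ≤ wtM k := Finsupp.le_weight wgt (wgt_pos c) k

theorem wgt_le_wtM (k : ℕ →₀ ℕ) (c : ℕ) (h : k c ≠ 0) : wgt c ≤ wtM k :=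
  Finsupp.le_weight_of_ne_zero' wgt h

theorem wtM_eq_sum (k : ℕ →₀ ℕ) (s : Finset ℕ) (h : k.support ⊆ s) :
    wtM k = ∑ c ∈ s, k c * wgt c := by
  rw [wtM, Finsupp.weight_apply, Finsupp.sum_of_support_subset _ h _ (by simp)]
  simp

/-- exponents of weight `n` -/
noncomputable def SM (n : ℕ) : Finset (ℕ →₀ ℕ) :=
  ((Finset.range (n + 1)).finsupp (fun _ => Finset.range (n + 1))).filter (fun k => wtM k = n)

theorem mem_SM {n : ℕ} {k : ℕ →₀ ℕ} : k ∈ SM n ↔ wtM k = n := by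
  unfold SM
  rw [Finset.mem_filter, Finset.mem_finsupp_iff]
  refine ⟨fun h => h.2, fun h => ⟨⟨fun c hc => ?_, fun c _ => ?_⟩, h⟩⟩
  · have := wgt_le_wtM k c (Finsupp.mem_support_iff.1 hc)
    unfold wgt at this
    rw [Finset.mem_range]; omega
  · have := le_wtM k c
    rw [Finset.mem_range]; omega

noncomputable def denM (k : ℕ →₀ ℕ) : ℝ :=
  k.prod (fun c e => (Nat.factorial c : ℝ) ^ e * Nat.factorial e)

theorem denM_eq (k : ℕ →₀ ℕ) (s : Finset ℕ) (h : k.support ⊆ s) :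
    denM k = ∏ c ∈ s, ((Nat.factorial c : ℝ) ^ (k c) * Nat.factorial (k c)) :=
  Finsupp.prod_of_support_subset _ h _ (by simp)

theorem denM_ne (k : ℕ →₀ ℕ) : denM k ≠ 0 := by
  unfold denM Finsupp.prod
  rw [Finset.prod_ne_zero_iff]
  intro c _
  positivity

theorem denM_add_single (k : ℕ →₀ ℕ) (c : ℕ) :
    denM (k + Finsupp.single c 1) = denM k * (Nat.factorial c * (k c + 1)) := by
  have h1 : k.support ⊆ insert c k.support := Finset.subset_insert _ _
  have h2 : (k + Finsupp.single c 1).support ⊆ insert c k.support := by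
    intro i hi
    rw [Finsupp.mem_support_iff] at hi
    by_cases h : i = c
    · simp [h]
    · have h' : c ≠ i := fun e => h e.symm
      simp [h'] at hi
      simp [hi]
  rw [denM_eq _ _ h1, denM_eq _ _ h2, ← Finset.mul_prod_erase _ _ (Finset.mem_insert_self c _),
    ← Finset.mul_prod_erase (insert c k.support) _ (Finset.mem_insert_self c _)]
  have : ∀ i ∈ (insert c k.support).erase c, (k + Finsupp.single c 1 : ℕ →₀ ℕ) i = k i := by
    intro i hi
    have h' : c ≠ i := fun e => (Finset.mem_erase.1 hi).1 e.symm
    simp [Finsupp.single_apply, h']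
  rw [Finset.prod_congr rfl (fun i hi => by rw [this i hi])]
  simp only [Finsupp.add_apply, Finsupp.single_eq_same, pow_succ, Nat.factorial_succ]
  push_cast
  ring

/-- the complete Bell polynomial -/
noncomputable def BM (n : ℕ) : MvPolynomial ℕ ℝ :=
  ∑ k ∈ SM n, monomial k ((Nat.factorial n : ℝ) / denM k)

theorem coeff_BM (n : ℕ) (k : ℕ →₀ ℕ) :
    coeff k (BM n) = if wtM k = n then (Nat.factorial n : ℝ) / denM k else 0 := by
  simp only [BM, coeff_sum, coeff_monomial, Finset.sum_ite_eq', mem_SM]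

theorem pderiv_BM (n c : ℕ) (h : wgt c ≤ n) :
    pderiv c (BM n) = C ((Nat.factorial n : ℝ) / (Nat.factorial c * Nat.factorial (n - wgt c)))
      * BM (n - wgt c) := by
  ext k
  rw [coeff_pderiv, coeff_C_mul, coeff_BM, coeff_BM, wtM_add, wtM_single, one_mul]
  by_cases hk : wtM k = n - wgt c
  · rw [if_pos hk, if_pos (by omega), denM_add_single]
    have := denM_ne k
    have h1 : ((k c : ℝ) + 1) ≠ 0 := by positivity
    field_simp
  · rw [if_neg hk, if_neg (by omega)]; simp

theorem pderiv_BM_zero (n c : ℕ) (h : n < wgt c) : pderiv c (BM n) = 0 := by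
  ext k
  rw [coeff_pderiv, coeff_BM, wtM_add, wtM_single, one_mul, if_neg (by omega)]; simp

theorem BM_zero : BM 0 = 1 := by
  ext k
  rw [coeff_BM, coeff_one]
  by_cases h : 0 = k
  · subst h; simp [wtM, denM]
  · rw [if_neg h, if_neg]
    intro h'
    apply h
    ext c
    have := le_wtM k c
    simp; omega

theorem pderiv_BM_choose (n c : ℕ) (h0 : 1 ≤ c) (h : c ≤ n) :
    pderiv c (BM n) = C (Nat.choose n c : ℝ) * BM (n - c) := by
  have hw : wgt c = c := by unfold wgt; omega
  rw [pderiv_BM n c (by omega), hw, Nat.cast_choose ℝ h]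

theorem pderiv_BM_x (n : ℕ) : pderiv 0 (BM (n + 1)) = C ((n : ℝ) + 1) * BM n := by
  have hw : wgt 0 = 1 := rfl
  rw [pderiv_BM _ _ (by omega), hw, Nat.add_sub_cancel, Nat.factorial_succ]
  congr 2
  have : (Nat.factorial n : ℝ) ≠ 0 := by positivity
  push_cast
  field_simp
  simp

theorem BM_euler (n : ℕ) :
    C (n : ℝ) * BM n = ∑ c ∈ Finset.range (n + 1), C (wgt c : ℝ) * (X c * pderiv c (BM n)) := by
  conv_rhs => rw [BM]
  simp only [map_sum, Finset.mul_sum]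
  rw [Finset.sum_comm, BM, Finset.mul_sum]
  refine Finset.sum_congr rfl fun k hk => ?_
  simp only [X_mul_pderiv_monomial]
  rw [mem_SM] at hk
  have h := wtM_eq_sum k (Finset.range (n + 1)) (fun c hc => by
    have := wgt_le_wtM k c (Finsupp.mem_support_iff.1 hc)
    unfold wgt at this
    rw [Finset.mem_range]; omega)
  rw [hk] at h
  have hc : (n : ℝ) = ∑ c ∈ Finset.range (n + 1), (k c : ℝ) * wgt c := by exact_mod_cast h
  have hC : (C (n : ℝ) : MvPolynomial ℕ ℝ)
      = ∑ c ∈ Finset.range (n + 1), C ((k c : ℝ) * wgt c) := by rw [← map_sum, ← hc]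
  rw [hC, Finset.sum_mul]
  simp only [nsmul_eq_mul]
  refine Finset.sum_congr rfl fun c _ => ?_
  simp only [map_mul, map_natCast]
  ring

/-- formal total derivative -/
noncomputable def EM (lam : ℕ) (Q : MvPolynomial ℕ ℝ) : MvPolynomial ℕ ℝ :=
  X 0 * Q + ∑ c ∈ Finset.range lam, X (c + 1) * (if c = 0 then Q else pderiv c Q)

theorem EM_BM (n lam : ℕ) (h : n + 1 ≤ lam) : EM lam (BM n) = BM (n + 1) := by
  have h1 : EM lam (BM n) = EM (n + 1) (BM n) := by
    unfold EM
    congr 1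
    symm
    apply Finset.sum_subset
    · intro c hc; rw [Finset.mem_range] at *; omega
    · intro c _ hc
      rw [Finset.mem_range] at hc
      rw [if_neg (by omega), pderiv_BM_zero _ _ (by unfold wgt; omega), mul_zero]
  have hne : (C ((n : ℝ) + 1) : MvPolynomial ℕ ℝ) ≠ 0 := by
    rw [Ne, C_eq_zero]; positivity
  rw [h1]
  apply mul_left_cancel₀ hne
  have e := BM_euler (n + 1)
  push_cast at e
  rw [e, Finset.sum_range_succ', pderiv_BM_x, EM]
  have hw0 : wgt 0 = 1 := rfl
  have key : C ((n : ℝ) + 1) * (∑ c ∈ Finset.range (n + 1),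
      X (c + 1) * (if c = 0 then BM n else pderiv c (BM n))) =
      ∑ c ∈ Finset.range (n + 1),
        C (wgt (c + 1) : ℝ) * (X (c + 1) * pderiv (c + 1) (BM (n + 1))) := by
    rw [Finset.mul_sum]
    refine Finset.sum_congr rfl fun c hc => ?_
    rw [Finset.mem_range] at hc
    rw [pderiv_BM_choose (n + 1) (c + 1) (by omega) (by omega)]
    have hw : wgt (c + 1) = c + 1 := by unfold wgt; omega
    have hB : (if c = 0 then BM n else pderiv c (BM n)) = C (Nat.choose n c : ℝ) * BM (n - c) := by
      split_ifs with h0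
      · subst h0; simp
      · exact pderiv_BM_choose n c (by omega) (by omega)
    rw [hB, hw, Nat.add_sub_add_right]
    have := Nat.add_one_mul_choose_eq n c
    have h2 : ((n : ℝ) + 1) * (Nat.choose n c : ℝ) = (Nat.choose (n + 1) (c + 1) : ℝ) * (c + 1) := by
      exact_mod_cast this
    have h3 : C ((n : ℝ) + 1) * C (Nat.choose n c : ℝ)
      = (C (Nat.choose (n + 1) (c + 1) : ℝ) * C ((c : ℝ) + 1) : MvPolynomial ℕ ℝ) := by
      rw [← C_mul, ← C_mul, h2]
    have h4 : (C ((c + 1 : ℕ) : ℝ) : MvPolynomial ℕ ℝ) = C ((c : ℝ) + 1) := by push_cast; rfl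
    rw [h4]
    generalize BM (n - c) = b at *
    generalize (X (c + 1) : MvPolynomial ℕ ℝ) = z at *
    generalize (C ((n : ℝ) + 1) : MvPolynomial ℕ ℝ) = u at *
    generalize (C ((c : ℝ) + 1) : MvPolynomial ℕ ℝ) = v at *
    generalize (C (Nat.choose n c : ℝ) : MvPolynomial ℕ ℝ) = p at *
    generalize (C (Nat.choose (n + 1) (c + 1) : ℝ) : MvPolynomial ℕ ℝ) = q at *
    linear_combination (z * b) * h3
  rw [← key, hw0, Nat.cast_one, C_1]
  ring


noncomputable def jetG {m : ℕ} (F : ℝ → (Fin m → ℝ) → ℝ) (Q : MvPolynomial ℕ ℝ) :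
    ℝ → (Fin m × ℕ → ℝ) → ℝ :=
  fun x P => opL F x (fun l => P (l, 0)) (symPhi P Q)

theorem jetG_hasDeriv_x {m : ℕ} {F : ℝ → (Fin m → ℝ) → ℝ} (h : SmM F) (Q : MvPolynomial ℕ ℝ)
    (x : ℝ) (P : Fin m × ℕ → ℝ) :
    HasDerivAt (fun t => jetG F Q t P) (jetG F (X 0 * Q) x P) x := by
  have := opL_hasDeriv_x h x (fun l => P (l, 0)) (symPhi P Q)
  refine this.congr_deriv ?_
  unfold jetG
  rw [map_mul (symPhi P)]
  congr 2
  simp [symPhi, symV]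

theorem jetG_hasDeriv_c {m : ℕ} {F : ℝ → (Fin m → ℝ) → ℝ} (h : SmM F) (Q : MvPolynomial ℕ ℝ)
    (x : ℝ) (P : Fin m × ℕ → ℝ) (l : Fin m) (c : ℕ) :
    HasDerivAt (fun t => jetG F Q x (Function.update P (l, c) t))
      (opL F x (fun l => P (l, 0))
        (X (some l) * symPhi P (if c = 0 then Q else pderiv c Q))) (P (l, c)) := by
  unfold jetG
  split_ifs with hc
  · subst hc
    have := opL_hasDeriv_y h x (fun l => P (l, 0)) l (symPhi P Q)
    refine this.congr_of_eventuallyEq (Filter.Eventually.of_forall fun t => ?_)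
    simp only [symPhi_update_zero]
    congr 2
    funext l'
    by_cases hl : l' = l
    · subst hl; simp
    · rw [Function.update_of_ne hl, Function.update_of_ne (by simpa using hl)]
  · have := symPhi_hasDeriv P l c hc Q (opL F x (fun l => P (l, 0)))
    refine this.congr_of_eventuallyEq (Filter.Eventually.of_forall fun t => ?_)
    have e : (fun l' => Function.update P (l, c) t (l', 0)) = fun l' => P (l', 0) := by
      funext l'
      rw [Function.update_of_ne]
      intro e
      exact hc (congrArg Prod.snd e).symm
    simp only [e]

/-- differentiable along coordinate lines -/
def JD {m : ℕ} (G : ℝ → (Fin m × ℕ → ℝ) → ℝ) : Prop :=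
  (∀ x P, DifferentiableAt ℝ (fun t => G t P) x) ∧
  (∀ x P l c, DifferentiableAt ℝ (fun t => G x (Function.update P (l, c) t)) (P (l, c)))

theorem jetG_JD {m : ℕ} {F : ℝ → (Fin m → ℝ) → ℝ} (h : SmM F) (Q : MvPolynomial ℕ ℝ) :
    JD (jetG F Q) :=
  ⟨fun x P => (jetG_hasDeriv_x h Q x P).differentiableAt,
    fun x P l c => (jetG_hasDeriv_c h Q x P l c).differentiableAt⟩

theorem totalD_jetG {m : ℕ} {F : ℝ → (Fin m → ℝ) → ℝ} (h : SmM F) (Q : MvPolynomial ℕ ℝ)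
    (lam : ℕ) : totalDm lam (jetG F Q) = jetG F (EM lam Q) := by
  funext x P
  unfold totalDm
  rw [(jetG_hasDeriv_x h Q x P).deriv]
  simp only [(jetG_hasDeriv_c h Q x P _ _).deriv]
  rw [Finset.sum_comm]
  unfold jetG EM
  rw [map_add, map_add, map_sum, map_sum]
  congr 1
  refine Finset.sum_congr rfl fun c _ => ?_
  rw [map_mul (symPhi P)]
  have : symPhi P (X (c + 1)) = ∑ l : Fin m, C (P (l, c + 1)) * X (some l) := by
    simp [symPhi, symV]
  rw [this, Finset.sum_mul, map_sum]
  refine Finset.sum_congr rfl fun l _ => ?_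
  rw [mul_assoc, ← smul_eq_C_mul, map_smul, smul_eq_mul]

theorem JD.mul {m : ℕ} {G H : ℝ → (Fin m × ℕ → ℝ) → ℝ} (hG : JD G) (hH : JD H) :
    JD (fun x P => G x P * H x P) :=
  ⟨fun x P => (hG.1 x P).mul (hH.1 x P), fun x P l c => (hG.2 x P l c).mul (hH.2 x P l c)⟩

theorem JD.const {m : ℕ} (a : ℝ) : JD (fun (_ : ℝ) (_ : Fin m × ℕ → ℝ) => a) :=
  ⟨fun _ _ => differentiableAt_const _, fun _ _ _ _ => differentiableAt_const _⟩

theorem JD.sum {m : ℕ} {ι : Type*} (s : Finset ι) {G : ι → ℝ → (Fin m × ℕ → ℝ) → ℝ}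
    (hG : ∀ i, JD (G i)) : JD (fun x P => ∑ i ∈ s, G i x P) :=
  ⟨fun x P => DifferentiableAt.fun_sum fun i _ => (hG i).1 x P,
   fun x P l c => DifferentiableAt.fun_sum fun i _ => (hG i).2 x P l c⟩

theorem coord_hasDeriv {m : ℕ} (a : Fin m × ℕ) (P : Fin m × ℕ → ℝ) (b : Fin m × ℕ) :
    HasDerivAt (fun t => Function.update P b t a) (if a = b then 1 else 0) (P b) := by
  by_cases h : a = b
  · subst h; simpa using hasDerivAt_id' (P a)
  · simpa [h] using hasDerivAt_const _ _

theorem JD.coord {m : ℕ} (a : Fin m × ℕ) : JD (fun (_ : ℝ) (P : Fin m × ℕ → ℝ) => P a) :=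
  ⟨fun _ _ => differentiableAt_const _, fun _ P l c =>
    (coord_hasDeriv a P (l, c)).differentiableAt⟩

theorem totalD_coord {m : ℕ} (j : Fin m) (i lam : ℕ) (h : i < lam) (x : ℝ) (P : Fin m × ℕ → ℝ) :
    totalDm lam (fun (_ : ℝ) (P : Fin m × ℕ → ℝ) => P (j, i)) x P = P (j, i + 1) := by
  unfold totalDm
  simp only [(coord_hasDeriv (j, i) P _).deriv, deriv_const, zero_add, Prod.mk.injEq]
  rw [Finset.sum_eq_single j, Finset.sum_eq_single i]
  · simp
  · intro c _ hc; simp [hc.symm]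
  · intro hi; exact absurd (Finset.mem_range.2 h) hi
  · intro l _ hl; simp [hl.symm]
  · simp

theorem totalD_const {m : ℕ} (a : ℝ) (lam : ℕ) (x : ℝ) (P : Fin m × ℕ → ℝ) :
    totalDm lam (fun (_ : ℝ) (_ : Fin m × ℕ → ℝ) => a) x P = 0 := by
  simp [totalDm]

theorem totalD_mul {m : ℕ} {G H : ℝ → (Fin m × ℕ → ℝ) → ℝ} (hG : JD G) (hH : JD H) (lam : ℕ)
    (x : ℝ) (P : Fin m × ℕ → ℝ) : totalDm lam (fun x P => G x P * H x P) x P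
      = totalDm lam G x P * H x P + G x P * totalDm lam H x P := by
  unfold totalDm
  rw [deriv_fun_mul (hG.1 x P) (hH.1 x P)]
  simp only [deriv_fun_mul (hG.2 x P _ _) (hH.2 x P _ _), Function.update_eq_self]
  simp only [mul_add, add_mul, Finset.sum_add_distrib, Finset.mul_sum, Finset.sum_mul]
  have e1 : ∀ l c, P (l, c + 1) * (deriv (fun t => G x (Function.update P (l, c) t)) (P (l, c)) * H x P)
     = P (l, c + 1) * deriv (fun t => G x (Function.update P (l, c) t)) (P (l, c)) * H x P :=
    fun _ _ => by ring
  have e2 : ∀ l c, P (l, c + 1) * (G x P * deriv (fun t => H x (Function.update P (l, c) t)) (P (l, c)))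
     = G x P * (P (l, c + 1) * deriv (fun t => H x (Function.update P (l, c) t)) (P (l, c))) :=
    fun _ _ => by ring
  simp only [e1, e2]
  ring

theorem totalD_sub {m : ℕ} {G H : ℝ → (Fin m × ℕ → ℝ) → ℝ} (hG : JD G) (hH : JD H) (lam : ℕ)
    (x : ℝ) (P : Fin m × ℕ → ℝ) : totalDm lam (fun x P => G x P - H x P) x P
      = totalDm lam G x P - totalDm lam H x P := by
  unfold totalDm
  rw [deriv_fun_sub (hG.1 x P) (hH.1 x P)]
  simp only [deriv_fun_sub (hG.2 x P _ _) (hH.2 x P _ _)]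
  simp only [mul_sub, Finset.sum_sub_distrib]
  ring

theorem totalD_sum {m : ℕ} {ι : Type*} (s : Finset ι) {G : ι → ℝ → (Fin m × ℕ → ℝ) → ℝ}
    (hG : ∀ i, JD (G i)) (lam : ℕ) (x : ℝ) (P : Fin m × ℕ → ℝ) :
    totalDm lam (fun x P => ∑ i ∈ s, G i x P) x P = ∑ i ∈ s, totalDm lam (G i) x P := by
  unfold totalDm
  rw [deriv_fun_sum (fun i _ => (hG i).1 x P)]
  simp only [deriv_fun_sum (fun i (_ : i ∈ s) => (hG i).2 x P _ _)]
  rw [Finset.sum_add_distrib]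
  congr 1
  rw [Finset.sum_comm]
  conv_rhs => rw [Finset.sum_comm' (t' := Finset.univ) (s' := fun _ => s) (by simp)]
  rw [Finset.sum_comm]
  refine Finset.sum_congr rfl fun l _ => ?_
  rw [Finset.sum_comm]
  refine Finset.sum_congr rfl fun c _ => ?_
  rw [Finset.mul_sum]

theorem jetG_one {m : ℕ} {F : ℝ → (Fin m → ℝ) → ℝ} (h : SmM F) :
    jetG F 1 = fun x P => F x (fun l => P (l, 0)) := by
  funext x P
  have := opL_list h x (fun l => P (l, 0)) 0 []
  simp only [pow_zero, List.map_nil, List.prod_nil, mul_one] at this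
  rw [jetG, map_one, this]
  rfl

theorem prolong_eq {m : ℕ} {F : ℝ → (Fin m → ℝ) → ℝ} {Y : Fin m → ℝ → (Fin m → ℝ) → ℝ}
    (hF : SmM F) (hY : ∀ j, SmM (Y j)) (j : Fin m) (n : ℕ) :
    prolongM F Y j n = fun x P => jetG (Y j) (BM n) x P -
      ∑ i ∈ Finset.range n, (Nat.choose n (i + 1) : ℝ) *
        (jetG F (BM (i + 1)) x P * P (j, n - i)) := by
  induction n with
  | zero =>
    funext x P
    simp only [prolongM, BM_zero, jetG_one (hY j)]
    simp
  | succ n ih =>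
    funext x P
    rw [prolongM, ih]
    beta_reduce
    have hs : ∀ i, JD (fun x P => (Nat.choose n (i + 1) : ℝ) *
        (jetG F (BM (i + 1)) x P * P (j, n - i))) := fun i =>
      (JD.const _).mul ((jetG_JD hF _).mul (JD.coord _))
    rw [totalD_sub (jetG_JD (hY j) _) (JD.sum _ hs), totalD_sum _ hs, totalD_jetG (hY j),
      EM_BM _ _ le_rfl, ← jetG_one hF, totalD_jetG hF, ← BM_zero, EM_BM _ _ le_rfl]
    have e : ∀ i ∈ Finset.range n, totalDm (n + 1) (fun x P => (Nat.choose n (i + 1) : ℝ) *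
        (jetG F (BM (i + 1)) x P * P (j, n - i))) x P =
        (Nat.choose n (i + 1) : ℝ) * (jetG F (BM (i + 1 + 1)) x P * P (j, n + 1 - (i + 1)))
        + (Nat.choose n (i + 1) : ℝ) * (jetG F (BM (i + 1)) x P * P (j, n + 1 - i)) := by
      intro i hi
      rw [Finset.mem_range] at hi
      rw [totalD_mul (JD.const _) ((jetG_JD hF _).mul (JD.coord _)), totalD_const,
        totalD_mul (jetG_JD hF _) (JD.coord _), totalD_jetG hF, EM_BM _ _ (by omega),
        totalD_coord _ _ _ (by omega), show n + 1 - (i + 1) = n - i by omega,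
        show n + 1 - i = n - i + 1 by omega]
      ring
    rw [Finset.sum_congr rfl e, Finset.sum_add_distrib]
    have p : ∀ i ∈ Finset.range (n + 1), (Nat.choose (n + 1) (i + 1) : ℝ) *
        (jetG F (BM (i + 1)) x P * P (j, n + 1 - i)) =
        (Nat.choose n i : ℝ) * (jetG F (BM (i + 1)) x P * P (j, n + 1 - i)) +
        (Nat.choose n (i + 1) : ℝ) * (jetG F (BM (i + 1)) x P * P (j, n + 1 - i)) := by
      intro i _
      rw [Nat.choose_succ_succ]; push_cast; ring
    rw [Finset.sum_congr rfl p, Finset.sum_add_distrib, Finset.sum_range_succ',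
      Finset.sum_range_succ (fun i => (Nat.choose n (i + 1) : ℝ) *
        (jetG F (BM (i + 1)) x P * P (j, n + 1 - i)))]
    simp only [Nat.choose_succ_self, Nat.choose_zero_right, Nat.cast_zero, Nat.cast_one, zero_add,
      Nat.sub_zero, zero_mul, one_mul, add_zero]
    ring

theorem prolong_eq' {m : ℕ} {F : ℝ → (Fin m → ℝ) → ℝ} {Y : Fin m → ℝ → (Fin m → ℝ) → ℝ}
    (hF : SmM F) (hY : ∀ j, SmM (Y j)) (j : Fin m) (n : ℕ) (x : ℝ) (P : Fin m × ℕ → ℝ) :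
    prolongM F Y j n x P = ∑ k ∈ SM (n + 1), (Nat.factorial n : ℝ) / denM k *
      (jetG (Y j) (pderiv 0 (monomial k 1)) x P -
        ∑ c ∈ Finset.range n, ((c : ℝ) + 1) * P (j, c + 1) *
          jetG F (pderiv (c + 1) (monomial k 1)) x P) := by
  have hlin : ∀ (G : ℝ → (Fin m → ℝ) → ℝ) (c : ℕ),
      ∑ k ∈ SM (n + 1), (Nat.factorial n : ℝ) / denM k * jetG G (pderiv c (monomial k 1)) x P
       = ((n : ℝ) + 1)⁻¹ * jetG G (pderiv c (BM (n + 1))) x P := by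
    intro G c
    have hn : ((n : ℝ) + 1) ≠ 0 := by positivity
    unfold jetG BM
    simp only [map_sum]
    rw [Finset.mul_sum]
    refine Finset.sum_congr rfl fun k _ => ?_
    have : (monomial k ((Nat.factorial (n + 1) : ℝ) / denM k) : MvPolynomial ℕ ℝ)
      = ((Nat.factorial (n + 1) : ℝ) / denM k) • monomial k 1 := by
      rw [smul_monomial, smul_eq_mul, mul_one]
    rw [this]
    simp only [map_smul, smul_eq_mul, Derivation.map_smul]
    rw [Nat.factorial_succ]
    push_cast
    field_simp
  have hC : ∀ (G : ℝ → (Fin m → ℝ) → ℝ) (a : ℝ) (Q : MvPolynomial ℕ ℝ),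
      jetG G (C a * Q) x P = a * jetG G Q x P := by
    intro G a Q
    unfold jetG
    rw [← smul_eq_C_mul, map_smul, map_smul, smul_eq_mul]
  have hn : ((n : ℝ) + 1) ≠ 0 := by positivity
  rw [prolong_eq hF hY]
  simp only [mul_sub, Finset.sum_sub_distrib, Finset.mul_sum]
  rw [hlin, pderiv_BM_x, hC, Finset.sum_comm]
  congr 1
  · field_simp
  · rw [← Finset.sum_range_reflect]
    refine Finset.sum_congr rfl fun c hc => ?_
    rw [Finset.mem_range] at hc
    have e : ∀ k, (Nat.factorial n : ℝ) / denM k * (((c : ℝ) + 1) * P (j, c + 1) *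
          jetG F (pderiv (c + 1) (monomial k 1)) x P) = (((c : ℝ) + 1) * P (j, c + 1)) *
          ((Nat.factorial n : ℝ) / denM k * jetG F (pderiv (c + 1) (monomial k 1)) x P) :=
      fun k => by ring
    simp only [e]
    rw [← Finset.mul_sum, hlin, pderiv_BM_choose _ _ (by omega) (by omega), hC,
      show n - 1 - c + 1 = n - c by omega, show n + 1 - (c + 1) = n - c by omega,
      show n - (n - 1 - c) = c + 1 by omega, Nat.choose_symm (by omega)]
    have h2 : ((n : ℝ) + 1) * (Nat.choose n c : ℝ) = (Nat.choose (n + 1) (c + 1) : ℝ) * (c + 1) := by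
      exact_mod_cast Nat.add_one_mul_choose_eq n c
    field_simp
    linear_combination (jetG F (BM (n - c)) x P * P (j, c + 1)) * h2


/-- the exponent vector attached to block data -/
noncomputable def kOf {d : ℕ} (a : ℕ) (lam nu : Fin d → ℕ) : ℕ →₀ ℕ :=
  Finsupp.single 0 a + ∑ e, Finsupp.single (lam e + 1) (nu e)

theorem kOf_zero {d : ℕ} (a : ℕ) (lam nu : Fin d → ℕ) : kOf a lam nu 0 = a := by
  simp [kOf, Finsupp.finsetSum_apply]

theorem kOf_succ {d : ℕ} (a : ℕ) (lam nu : Fin d → ℕ) (c : ℕ) :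
    kOf a lam nu (c + 1) = ∑ e, if lam e = c then nu e else 0 := by
  simp [kOf, Finsupp.finsetSum_apply, Finsupp.single_apply]

theorem kOf_lam {d : ℕ} (a : ℕ) (lam nu : Fin d → ℕ) (hl : Function.Injective lam) (e : Fin d) :
    kOf a lam nu (lam e + 1) = nu e := by
  rw [kOf_succ, Finset.sum_eq_single e]
  · simp
  · intro b _ hb
    rw [if_neg]
    exact fun h => hb (hl h)
  · simp

theorem kOf_notMem {d : ℕ} (a : ℕ) (lam nu : Fin d → ℕ) (c : ℕ) (h : ∀ e, lam e ≠ c) :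
    kOf a lam nu (c + 1) = 0 := by
  rw [kOf_succ]
  exact Finset.sum_eq_zero fun e _ => if_neg (h e)

theorem kOf_wt {d : ℕ} (a : ℕ) (lam nu : Fin d → ℕ) :
    wtM (kOf a lam nu) = a + ∑ e, nu e * (lam e + 1) := by
  unfold kOf
  rw [wtM_add, wtM_single]
  have h0 : wgt 0 = 1 := rfl
  have h1 : ∀ c, wgt (c + 1) = c + 1 := fun c => by unfold wgt; omega
  have : wtM (∑ e, Finsupp.single (lam e + 1) (nu e)) = ∑ e, nu e * (lam e + 1) := by
    unfold wtM
    rw [map_sum]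
    refine Finset.sum_congr rfl fun e _ => ?_
    have := wtM_single (lam e + 1) (nu e)
    unfold wtM at this
    rw [this, h1]
  rw [this, h0, mul_one]

theorem kOf_den {d : ℕ} (a : ℕ) (lam nu : Fin d → ℕ) (hl : Function.Injective lam) :
    denM (kOf a lam nu) = (Nat.factorial a : ℝ) *
      ∏ e, ((Nat.factorial (lam e + 1) : ℝ) ^ (nu e) * Nat.factorial (nu e)) := by
  classical
  have hs : (kOf a lam nu).support ⊆ insert 0 (Finset.univ.image fun e => lam e + 1) := by
    intro c hc
    rw [Finsupp.mem_support_iff] at hc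
    cases c with
    | zero => simp
    | succ c =>
      by_contra hn
      apply hc
      apply kOf_notMem
      intro e he
      apply hn
      simp only [Finset.mem_insert, Finset.mem_image]
      exact Or.inr ⟨e, Finset.mem_univ _, by rw [he]⟩
  rw [denM_eq _ _ hs, Finset.prod_insert (by simp), Finset.prod_image, kOf_zero]
  · simp only [kOf_lam a lam nu hl]
    simp
  · intro e _ e' _ h
    exact hl (Nat.succ_injective h)

theorem kOf_phi {m d : ℕ} (P : Fin m × ℕ → ℝ) (a : ℕ) (lam nu : Fin d → ℕ) (r : ℝ) :
    symPhi P (monomial (kOf a lam nu) r) =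
      C r * (X none ^ a * ∏ e, symV P (lam e + 1) ^ nu e) := by
  unfold kOf
  have : (monomial (Finsupp.single 0 a + ∑ e, Finsupp.single (lam e + 1) (nu e)) r :
      MvPolynomial ℕ ℝ) = C r * (X 0 ^ a * ∏ e, X (lam e + 1) ^ nu e) := by
    rw [monomial_single_add, monomial_sum_index]
    simp only [X_pow_eq_monomial]
    ring
  rw [this]
  simp only [map_mul, map_pow, map_prod, symPhi, aeval_X]
  rw [aeval_C]
  simp [symV, algebraMap_eq]

theorem kOf_sub_zero {d : ℕ} (a : ℕ) (lam nu : Fin d → ℕ) :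
    kOf a lam nu - Finsupp.single 0 1 = kOf (a - 1) lam nu := by
  ext c
  cases c with
  | zero => rw [Finsupp.tsub_apply, kOf_zero, kOf_zero]; simp
  | succ c => rw [Finsupp.tsub_apply, kOf_succ, kOf_succ]; simp

theorem kOf_sub_lam {d : ℕ} (a : ℕ) (lam nu : Fin d → ℕ) (hl : Function.Injective lam)
    (e : Fin d) : kOf a lam nu - Finsupp.single (lam e + 1) 1 =
      kOf a lam (fun e' => if e' = e then nu e' - 1 else nu e') := by
  ext c
  cases c with
  | zero => rw [Finsupp.tsub_apply, kOf_zero, kOf_zero]; simp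
  | succ c =>
    rw [Finsupp.tsub_apply]
    by_cases h : ∃ e', lam e' = c
    · obtain ⟨e', rfl⟩ := h
      rw [kOf_lam _ _ _ hl, kOf_lam _ _ _ hl]
      by_cases he : e' = e
      · subst he; simp
      · have : lam e + 1 ≠ lam e' + 1 := fun h => he (hl (Nat.succ_injective h)).symm
        rw [if_neg he, Finsupp.single_apply, if_neg this]; rfl
    · push Not at h
      rw [kOf_notMem _ _ _ _ h, kOf_notMem _ _ _ _ h]; simp

theorem sum_blk {m d : ℕ} {mu' : Fin d → ℕ} {R : Type*} [CommRing R]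
    (g : ((e : Fin d) × Fin (mu' e + 1)) → Fin m → R) :
    ∑ l : ((e : Fin d) × Fin (mu' e + 1)) → Fin m, ∏ s, g s (l s) = ∏ s, ∑ i, g s i := by
  rw [Finset.prod_univ_sum, Fintype.piFinset_univ]

theorem blkList_prod {m d : ℕ} {mu' : Fin d → ℕ} {R : Type*} [CommRing R]
    (l : ((e : Fin d) × Fin (mu' e + 1)) → Fin m) (f : Fin m → R) :
    ((blkList l).map f).prod = ∏ s, f (l s) := by
  unfold blkList
  rw [List.map_flatten, List.prod_flatten, List.map_map, List.map_map, Fintype.prod_sigma,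
    Fin.prod_univ_def]
  congr 1
  refine List.map_congr_left fun e _ => ?_
  simp [List.map_ofFn, List.prod_ofFn, Fin.prod_univ_succ]

theorem blkListDrop_prod {m d : ℕ} {mu' : Fin d → ℕ} {R : Type*} [CommRing R]
    (l : ((e : Fin d) × Fin (mu' e + 1)) → Fin m) (e₀ : Fin d) (f : Fin m → R) :
    ((blkListDrop l e₀).map f).prod = ∏ s, if s = ⟨e₀, 0⟩ then 1 else f (l s) := by
  unfold blkListDrop
  rw [List.map_flatten, List.prod_flatten, List.map_map, List.map_map, Fintype.prod_sigma,
    Fin.prod_univ_def]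
  congr 1
  refine List.map_congr_left fun e _ => ?_
  by_cases he : e = e₀
  · subst he
    simp [List.ofFn_succ, List.map_ofFn, List.prod_ofFn, Fin.prod_univ_succ]
  · have : ∀ ν : Fin (mu' e + 1), (⟨e, ν⟩ : (e : Fin d) × Fin (mu' e + 1)) ≠ ⟨e₀, 0⟩ :=
      fun ν h => he (congrArg Sigma.fst h)
    simp [he, List.map_ofFn, List.prod_ofFn, Fin.prod_univ_succ]

theorem sum_one {m d : ℕ} {mu' : Fin d → ℕ} {F : ℝ → (Fin m → ℝ) → ℝ} (h : SmM F) (x : ℝ)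
    (y : Fin m → ℝ) (P : Fin m × ℕ → ℝ) (b : ℕ) (lam : Fin d → ℕ) :
    ∑ l : ((e : Fin d) × Fin (mu' e + 1)) → Fin m,
      pdM b (blkList l) F x y * ∏ s, P (l s, lam s.1 + 1)
    = opL F x y (X none ^ b * ∏ e, symV P (lam e + 1) ^ (mu' e + 1)) := by
  have h1 : ∏ e, symV P (lam e + 1) ^ (mu' e + 1) =
      ∏ s : ((e : Fin d) × Fin (mu' e + 1)), ∑ i : Fin m, C (P (i, lam s.1 + 1)) * X (some i) := by
    rw [Fintype.prod_sigma]
    refine Finset.prod_congr rfl fun e _ => ?_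
    simp [symV]
  rw [h1, ← sum_blk (fun s i => C (P (i, lam s.1 + 1)) * X (some i)), Finset.mul_sum, map_sum]
  refine Finset.sum_congr rfl fun l _ => ?_
  rw [← opL_list h, blkList_prod, Finset.prod_mul_distrib, ← map_prod, mul_left_comm,
    ← smul_eq_C_mul, map_smul, smul_eq_mul, mul_comm]

theorem sum_two {m d : ℕ} {mu' : Fin d → ℕ} {F : ℝ → (Fin m → ℝ) → ℝ} (h : SmM F) (x : ℝ)
    (y : Fin m → ℝ) (P : Fin m × ℕ → ℝ) (b : ℕ) (lam : Fin d → ℕ) (j : Fin m) (e₀ : Fin d) :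
    ∑ l : ((e : Fin d) × Fin (mu' e + 1)) → Fin m,
      kron j (l ⟨e₀, 0⟩) * pdM b (blkListDrop l e₀) F x y * ∏ s, P (l s, lam s.1 + 1)
    = P (j, lam e₀ + 1) * opL F x y (X none ^ b *
        ∏ e, symV P (lam e + 1) ^ (if e = e₀ then mu' e + 1 - 1 else mu' e + 1)) := by
  have h1 : C (P (j, lam e₀ + 1)) *
      ∏ e, symV P (lam e + 1) ^ (if e = e₀ then mu' e + 1 - 1 else mu' e + 1) =
      ∏ s : ((e : Fin d) × Fin (mu' e + 1)), ∑ i : Fin m, C (P (i, lam s.1 + 1)) *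
        ((if s = ⟨e₀, 0⟩ then C (kron j i) else 1) * if s = ⟨e₀, 0⟩ then 1 else X (some i)) := by
    have e1 : ∀ s : ((e : Fin d) × Fin (mu' e + 1)), ∑ i : Fin m, C (P (i, lam s.1 + 1)) *
        ((if s = ⟨e₀, 0⟩ then C (kron j i) else 1) * if s = ⟨e₀, 0⟩ then 1 else X (some i))
        = (if s = ⟨e₀, 0⟩ then C (P (j, lam e₀ + 1)) else 1) *
          (if s = ⟨e₀, 0⟩ then 1 else symV P (lam s.1 + 1)) := by
      intro s
      by_cases hs : s = ⟨e₀, 0⟩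
      · subst hs
        simp [kron, apply_ite (C : ℝ → MvPolynomial (Option (Fin m)) ℝ)]
      · simp [hs, symV]
    rw [Finset.prod_congr rfl (fun s _ => e1 s), Finset.prod_mul_distrib, Finset.prod_ite_eq',
      if_pos (Finset.mem_univ _), Fintype.prod_sigma]
    congr 1
    refine Finset.prod_congr rfl fun e _ => ?_
    by_cases he : e = e₀
    · subst he
      simp [Fin.prod_univ_succ]
    · have : ∀ ν : Fin (mu' e + 1), (⟨e, ν⟩ : (e : Fin d) × Fin (mu' e + 1)) ≠ ⟨e₀, 0⟩ :=
        fun ν h => he (congrArg Sigma.fst h)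
      simp [he]
  rw [← smul_eq_mul (a := P (j, lam e₀ + 1)), ← map_smul, smul_eq_C_mul, mul_left_comm, h1,
    ← sum_blk (fun s i => C (P (i, lam s.1 + 1)) *
        ((if s = ⟨e₀, 0⟩ then C (kron j i) else 1) * if s = ⟨e₀, 0⟩ then 1 else X (some i))),
    Finset.mul_sum, map_sum]
  refine Finset.sum_congr rfl fun l _ => ?_
  rw [← opL_list h, blkListDrop_prod, Finset.prod_mul_distrib, Finset.prod_mul_distrib, ← map_prod,
    Finset.prod_ite_eq', if_pos (Finset.mem_univ _)]
  rw [mul_left_comm, ← smul_eq_C_mul, map_smul, mul_left_comm, ← smul_eq_C_mul, map_smul]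
  simp only [smul_eq_mul]
  ring

theorem term_eq {m d κ : ℕ} {mu' lam : Fin d → ℕ} {F G : ℝ → (Fin m → ℝ) → ℝ} (hF : SmM F)
    (hG : SmM G) (x : ℝ) (P : Fin m × ℕ → ℝ) (j : Fin m) (hd : 0 < d)
    (hl : Function.Injective lam) (hlk : ∀ e, lam e < κ)
    (hN : ∑ e, (mu' e + 1) * (lam e + 1) ≤ κ + 1) :
    ∑ l : ((e : Fin d) × Fin (mu' e + 1)) → Fin m,
          ((Nat.descFactorial κ ((∑ e, (mu' e + 1) * (lam e + 1)) - 1) : ℝ)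
              / ((∏ e, (Nat.factorial (lam e + 1)) ^ (mu' e + 1)
                    * Nat.factorial (mu' e + 1) : ℕ) : ℝ))
          * (((κ + 1 - ∑ e, (mu' e + 1) * (lam e + 1) : ℕ) : ℝ)
                * pdM (κ - ∑ e, (mu' e + 1) * (lam e + 1)) (blkList l) G x
                    (fun l' => P (l', 0))
              - ∑ e : Fin d,
                  kron j (l ⟨e, 0⟩) * (((mu' e + 1) * (lam e + 1) : ℕ) : ℝ)
                    * pdM (κ + 1 - ∑ e', (mu' e' + 1) * (lam e' + 1)) (blkListDrop l e) F x
                        (fun l' => P (l', 0)))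
          * ∏ e : Fin d, ∏ ν : Fin (mu' e + 1), P (l ⟨e, ν⟩, lam e + 1)
    = (Nat.factorial κ : ℝ) /
        denM (kOf (κ + 1 - ∑ e, (mu' e + 1) * (lam e + 1)) lam (fun e => mu' e + 1)) *
      (jetG G (pderiv 0 (monomial
        (kOf (κ + 1 - ∑ e, (mu' e + 1) * (lam e + 1)) lam (fun e => mu' e + 1)) 1)) x P -
        ∑ c ∈ Finset.range κ, ((c : ℝ) + 1) * P (j, c + 1) *
          jetG F (pderiv (c + 1) (monomial
            (kOf (κ + 1 - ∑ e, (mu' e + 1) * (lam e + 1)) lam (fun e => mu' e + 1)) 1)) x P) := by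
  classical
  have hN1 : 1 ≤ ∑ e, (mu' e + 1) * (lam e + 1) := by
    have := Finset.single_le_sum (f := fun e => (mu' e + 1) * (lam e + 1))
      (fun _ _ => Nat.zero_le _) (Finset.mem_univ (⟨0, hd⟩ : Fin d))
    refine le_trans ?_ this
    exact Nat.one_le_iff_ne_zero.2 (by positivity)
  generalize hNN : ∑ e, (mu' e + 1) * (lam e + 1) = N at *
  have hcoef : (Nat.descFactorial κ (N - 1) : ℝ)
      / ((∏ e, (Nat.factorial (lam e + 1)) ^ (mu' e + 1) * Nat.factorial (mu' e + 1) : ℕ) : ℝ)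
      = (Nat.factorial κ : ℝ) / denM (kOf (κ + 1 - N) lam (fun e => mu' e + 1)) := by
    rw [kOf_den _ _ _ hl]
    have h1 := Nat.factorial_mul_descFactorial (show N - 1 ≤ κ by omega)
    rw [show κ - (N - 1) = κ + 1 - N by omega] at h1
    rw [← h1]
    have h2 : (Nat.factorial (κ + 1 - N) : ℝ) ≠ 0 := by positivity
    push_cast
    rw [mul_div_mul_left _ _ h2]
  rw [hcoef]
  simp only [mul_assoc]
  rw [← Finset.mul_sum]
  congr 1
  have hprod : ∀ l : ((e : Fin d) × Fin (mu' e + 1)) → Fin m,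
      ∏ e : Fin d, ∏ ν : Fin (mu' e + 1), P (l ⟨e, ν⟩, lam e + 1) = ∏ s, P (l s, lam s.1 + 1) :=
    fun l => by rw [Fintype.prod_sigma]
  simp only [hprod, sub_mul, Finset.sum_sub_distrib, mul_assoc]
  congr 1
  · rw [← Finset.mul_sum, sum_one hG, pderiv_monomial, kOf_sub_zero, kOf_zero, jetG, kOf_phi,
      ← smul_eq_C_mul, map_smul, smul_eq_mul, one_mul, show κ + 1 - N - 1 = κ - N by omega]
  · simp only [Finset.sum_mul]
    rw [Finset.sum_comm]
    have hR : ∑ c ∈ Finset.range κ, ((c : ℝ) + 1) * (P (j, c + 1) *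
          jetG F (pderiv (c + 1) (monomial (kOf (κ + 1 - N) lam (fun e => mu' e + 1)) 1)) x P) =
        ∑ c ∈ Finset.univ.image lam, ((c : ℝ) + 1) * (P (j, c + 1) *
          jetG F (pderiv (c + 1) (monomial (kOf (κ + 1 - N) lam (fun e => mu' e + 1)) 1)) x P) := by
      symm
      apply Finset.sum_subset
      · intro c hc
        obtain ⟨e, _, rfl⟩ := Finset.mem_image.1 hc
        exact Finset.mem_range.2 (hlk e)
      · intro c _ hc
        rw [pderiv_monomial, kOf_notMem]
        · simp [jetG]
        · intro e he
          exact hc (Finset.mem_image.2 ⟨e, Finset.mem_univ _, he⟩)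
    rw [hR, Finset.sum_image (fun e _ e' _ h => hl h)]
    refine Finset.sum_congr rfl fun e _ => ?_
    rw [pderiv_monomial, kOf_sub_lam _ _ _ hl, kOf_lam _ _ _ hl, jetG, kOf_phi,
      ← smul_eq_C_mul, map_smul, smul_eq_mul, one_mul]
    have e3 : ∀ l : ((e : Fin d) × Fin (mu' e + 1)) → Fin m,
        kron j (l ⟨e, 0⟩) * ((((mu' e + 1) * (lam e + 1) : ℕ) : ℝ) *
          (pdM (κ + 1 - N) (blkListDrop l e) F x (fun l' => P (l', 0)) *
            ∏ s, P (l s, lam s.1 + 1))) = (((mu' e + 1) * (lam e + 1) : ℕ) : ℝ) *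
        (kron j (l ⟨e, 0⟩) * pdM (κ + 1 - N) (blkListDrop l e) F x (fun l' => P (l', 0)) *
            ∏ s, P (l s, lam s.1 + 1)) := fun l => by ring
    simp only [mul_assoc] at e3 ⊢
    rw [Finset.sum_congr rfl (fun l _ => e3 l)]
    have s2 := sum_two (mu' := mu') hF x (fun l' => P (l', 0)) P (κ + 1 - N) lam j e
    simp only [mul_assoc] at s2
    rw [← Finset.mul_sum, s2]
    push_cast
    ring

theorem kOf_surj (κ : ℕ) (k : ℕ →₀ ℕ) (hk : wtM k = κ + 1) (h1 : k ≠ Finsupp.single 0 (κ + 1))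
    (h2 : k ≠ Finsupp.single (κ + 1) 1) :
    ∃ (dm1 : ℕ) (lam mu' : Fin (dm1 + 1) → ℕ), dm1 < κ + 1 ∧ (∀ e, lam e < κ) ∧ StrictMono lam ∧
      (∀ e, mu' e < κ + 1) ∧ ∑ e, (mu' e + 1) * (lam e + 1) ≤ κ + 1 ∧
      kOf (κ + 1 - ∑ e, (mu' e + 1) * (lam e + 1)) lam (fun e => mu' e + 1) = k := by
  have hz : ∀ k' : ℕ →₀ ℕ, wtM k' = 0 → k' = 0 := by
    intro k' h'
    ext c
    have := le_wtM k' c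
    simp; omega
  have hlt : ∀ c, k (c + 1) ≠ 0 → c < κ := by
    intro c hc
    have := wgt_le_wtM k (c + 1) hc
    unfold wgt at this
    by_contra hcon
    have hce : c = κ := by omega
    subst hce
    apply h2
    have hle : Finsupp.single (c + 1) 1 ≤ k := Finsupp.single_le_iff.2 (by omega)
    obtain ⟨k', rfl⟩ := exists_add_of_le hle
    rw [wtM_add, wtM_single] at hk
    have hw : wgt (c + 1) = c + 1 := by unfold wgt; omega
    rw [hz k' (by omega), add_zero]
  set s : Finset ℕ := (Finset.range κ).filter (fun c => k (c + 1) ≠ 0) with hs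
  have hmem : ∀ c, c ∈ s ↔ k (c + 1) ≠ 0 := by
    intro c
    rw [hs, Finset.mem_filter, Finset.mem_range]
    exact ⟨fun h => h.2, fun h => ⟨hlt c h, h⟩⟩
  have hne : s.Nonempty := by
    by_contra hcon
    rw [Finset.not_nonempty_iff_eq_empty] at hcon
    apply h1
    have hk0 : k = Finsupp.single 0 (k 0) := by
      ext c
      cases c with
      | zero => simp
      | succ c =>
        have : c ∉ s := by rw [hcon]; simp
        rw [hmem] at this
        push Not at this
        rw [this]; simp
    rw [hk0, wtM_single] at hk
    have h0 : wgt 0 = 1 := rfl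
    rw [hk0]
    congr 1
    rw [h0, mul_one] at hk
    exact hk
  obtain ⟨dm1, hdm⟩ : ∃ dm1, s.card = dm1 + 1 :=
    ⟨s.card - 1, by have := Finset.card_pos.2 hne; omega⟩
  have hl_mem : ∀ e, s.orderEmbOfFin hdm e ∈ s := fun e => Finset.orderEmbOfFin_mem s hdm e
  have hlam : StrictMono (fun e => s.orderEmbOfFin hdm e) := (s.orderEmbOfFin hdm).strictMono
  have hmu : ∀ e, k (s.orderEmbOfFin hdm e + 1) - 1 + 1 = k (s.orderEmbOfFin hdm e + 1) := by
    intro e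
    have := (hmem _).1 (hl_mem e)
    omega
  have hkk : kOf (k 0) (fun e => s.orderEmbOfFin hdm e)
      (fun e => k (s.orderEmbOfFin hdm e + 1) - 1 + 1) = k := by
    ext c
    cases c with
    | zero => rw [kOf_zero]
    | succ c =>
      by_cases hc : c ∈ s
      · have : c ∈ Set.range (s.orderEmbOfFin hdm) := by rw [Finset.range_orderEmbOfFin]; exact hc
        obtain ⟨e, rfl⟩ := this
        rw [kOf_lam _ (fun e => s.orderEmbOfFin hdm e) _ hlam.injective, hmu]
      · rw [kOf_notMem]
        · rw [hmem] at hc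
          push Not at hc
          exact hc.symm
        · intro e he
          apply hc
          rw [← he]
          exact hl_mem e
  have hw := kOf_wt (k 0) (fun e => s.orderEmbOfFin hdm e)
      (fun e => k (s.orderEmbOfFin hdm e + 1) - 1 + 1)
  rw [hkk, hk] at hw
  refine ⟨dm1, fun e => s.orderEmbOfFin hdm e, fun e => k (s.orderEmbOfFin hdm e + 1) - 1,
    ?_, ?_, hlam, ?_, ?_, ?_⟩
  · have : s.card ≤ κ := by
      have := Finset.card_filter_le (Finset.range κ) (fun c => k (c + 1) ≠ 0)
      rwa [Finset.card_range] at this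
    omega
  · exact fun e => hlt _ ((hmem _).1 (hl_mem e))
  · intro e
    have := le_wtM k (s.orderEmbOfFin hdm e + 1)
    have := hmu e
    dsimp only
    omega
  · dsimp only
    omega
  · dsimp only
    rw [hw, Nat.add_sub_cancel]
    exact hkk

theorem reindex (κ : ℕ) (E : (ℕ →₀ ℕ) → ℝ) :
    ∑ dm1 ∈ Finset.range (κ + 1),
        ∑ lam' ∈ (Fintype.piFinset fun _ : Fin (dm1 + 1) => Finset.range κ).filter
            (fun lam' => ∀ a b : Fin (dm1 + 1), a < b → lam' a < lam' b),
        ∑ mu' ∈ (Fintype.piFinset fun _ : Fin (dm1 + 1) => Finset.range (κ + 1)).filter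
            (fun mu' => ∑ e, (mu' e + 1) * (lam' e + 1) ≤ κ + 1),
          E (kOf (κ + 1 - ∑ e, (mu' e + 1) * (lam' e + 1)) lam' (fun e => mu' e + 1))
    = ∑ k ∈ (SM (κ + 1)).filter
        (fun k => k ≠ Finsupp.single 0 (κ + 1) ∧ k ≠ Finsupp.single (κ + 1) 1), E k := by
  simp only [Finset.sum_sigma']
  refine Finset.sum_bij (fun t _ => kOf (κ + 1 - ∑ e, (t.2.2 e + 1) * (t.2.1 e + 1)) t.2.1
    (fun e => t.2.2 e + 1)) ?_ ?_ ?_ ?_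
  · rintro ⟨d, lam, mu⟩ ht
    simp only [Finset.mem_sigma, Finset.mem_filter, Fintype.mem_piFinset, Finset.mem_range] at ht
    obtain ⟨hd, ⟨hl, hm⟩, hmu, hN⟩ := ht
    have hinj : Function.Injective lam := StrictMono.injective (fun a b h => hm a b h)
    simp only [Finset.mem_filter, mem_SM]
    refine ⟨by rw [kOf_wt]; omega, ?_, ?_⟩
    · intro h
      have := congrArg (fun k : ℕ →₀ ℕ => k (lam 0 + 1)) h
      simp only [kOf_lam _ _ _ hinj] at this
      simp at this
    · intro h
      have := congrArg (fun k : ℕ →₀ ℕ => k (lam 0 + 1)) h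
      simp only [kOf_lam _ _ _ hinj] at this
      have h0 := hl 0
      rw [Finsupp.single_apply, if_neg (by omega)] at this
      omega
  · rintro ⟨d, lam, mu⟩ ht ⟨d', lam', mu'⟩ ht' h
    simp only [Finset.mem_sigma, Finset.mem_filter, Fintype.mem_piFinset, Finset.mem_range] at ht ht'
    obtain ⟨hd, ⟨hl, hm⟩, hmu, hN⟩ := ht
    obtain ⟨hd', ⟨hl', hm'⟩, hmu', hN'⟩ := ht'
    have hsm : StrictMono lam := fun a b h => hm a b h
    have hsm' : StrictMono lam' := fun a b h => hm' a b h
    simp only at h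
    have hr : ∀ {d : ℕ} (a : ℕ) (lam mu : Fin (d + 1) → ℕ), Function.Injective lam →
        Set.range lam = {c | kOf a lam (fun e => mu e + 1) (c + 1) ≠ 0} := by
      intro d a lam mu hi
      ext c
      constructor
      · rintro ⟨e, rfl⟩
        simp [kOf_lam _ _ _ hi]
      · intro hc
        by_contra hcon
        apply hc
        apply kOf_notMem
        intro e he
        exact hcon ⟨e, he⟩
    have hrange : Set.range lam = Set.range lam' := by
      rw [hr _ lam mu hsm.injective, hr _ lam' mu' hsm'.injective, h]
    have hcard : d + 1 = d' + 1 := by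
      have e1 := Set.ncard_range_of_injective hsm.injective
      have e2 := Set.ncard_range_of_injective hsm'.injective
      rw [hrange, e2] at e1
      simpa using e1.symm
    obtain rfl : d = d' := by omega
    obtain rfl : lam = lam' := (hsm.range_inj hsm').1 hrange
    have : mu = mu' := by
      funext e
      have := congrArg (fun k : ℕ →₀ ℕ => k (lam e + 1)) h
      simp only [kOf_lam _ _ _ hsm.injective] at this
      omega
    rw [this]
  · intro k hk
    simp only [Finset.mem_filter, mem_SM] at hk
    obtain ⟨d, lam, mu, h1, h2, h3, h4, h5, h6⟩ := kOf_surj κ k hk.1 hk.2.1 hk.2.2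
    refine ⟨⟨d, lam, mu⟩, ?_, h6⟩
    simp only [Finset.mem_sigma, Finset.mem_filter, Fintype.mem_piFinset, Finset.mem_range]
    exact ⟨h1, ⟨h2, fun a b h => h3 h⟩, h4, h5⟩
  · intro _ _; rfl



theorem split_sum (κ : ℕ) (hκ : 1 ≤ κ) (E : (ℕ →₀ ℕ) → ℝ) (h0 : E (Finsupp.single (κ + 1) 1) = 0) :
    ∑ k ∈ SM (κ + 1), E k = E (Finsupp.single 0 (κ + 1)) + ∑ k ∈ (SM (κ + 1)).filter
        (fun k => k ≠ Finsupp.single 0 (κ + 1) ∧ k ≠ Finsupp.single (κ + 1) 1), E k := by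
  classical
  have hw0 : wgt 0 = 1 := rfl
  have m1 : Finsupp.single 0 (κ + 1) ∈ SM (κ + 1) := by
    rw [mem_SM, wtM_single, hw0, mul_one]
  rw [← Finset.add_sum_erase _ _ m1]
  congr 1
  symm
  apply Finset.sum_subset
  · intro k hk
    rw [Finset.mem_filter] at hk
    exact Finset.mem_erase.2 ⟨hk.2.1, hk.1⟩
  · intro k hk hn
    rw [Finset.mem_erase] at hk
    rw [Finset.mem_filter] at hn
    have : k = Finsupp.single (κ + 1) 1 := by
      by_contra hc
      exact hn ⟨hk.2, hk.1, hc⟩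
    rw [this, h0]

theorem E_top {m : ℕ} {F G : ℝ → (Fin m → ℝ) → ℝ} (x : ℝ) (P : Fin m × ℕ → ℝ) (j : Fin m)
    (κ : ℕ) :
    (Nat.factorial κ : ℝ) / denM (Finsupp.single (κ + 1) 1) *
      (jetG G (pderiv 0 (monomial (Finsupp.single (κ + 1) 1) 1)) x P -
        ∑ c ∈ Finset.range κ, ((c : ℝ) + 1) * P (j, c + 1) *
          jetG F (pderiv (c + 1) (monomial (Finsupp.single (κ + 1) 1) 1)) x P) = 0 := by
  have h1 : pderiv 0 (monomial (Finsupp.single (κ + 1) 1) (1 : ℝ)) = 0 := by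
    rw [pderiv_monomial]; simp
  have h2 : ∑ c ∈ Finset.range κ, ((c : ℝ) + 1) * P (j, c + 1) *
          jetG F (pderiv (c + 1) (monomial (Finsupp.single (κ + 1) 1) 1)) x P = 0 := by
    refine Finset.sum_eq_zero fun c hc => ?_
    rw [Finset.mem_range] at hc
    rw [pderiv_monomial, Finsupp.single_apply, if_neg (by omega)]
    simp [jetG]
  rw [h1, h2]
  simp [jetG]

theorem E_bot {m : ℕ} {F G : ℝ → (Fin m → ℝ) → ℝ} (hG : SmM G) (x : ℝ) (P : Fin m × ℕ → ℝ)
    (j : Fin m) (κ : ℕ) :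
    (Nat.factorial κ : ℝ) / denM (Finsupp.single 0 (κ + 1)) *
      (jetG G (pderiv 0 (monomial (Finsupp.single 0 (κ + 1)) 1)) x P -
        ∑ c ∈ Finset.range κ, ((c : ℝ) + 1) * P (j, c + 1) *
          jetG F (pderiv (c + 1) (monomial (Finsupp.single 0 (κ + 1)) 1)) x P)
      = pdM κ [] G x (fun l => P (l, 0)) := by
  have hk : ∀ a : ℕ, (Finsupp.single 0 a : ℕ →₀ ℕ) = kOf a (Fin.elim0 : Fin 0 → ℕ) Fin.elim0 := by
    intro a; simp [kOf]
  have h2 : ∑ c ∈ Finset.range κ, ((c : ℝ) + 1) * P (j, c + 1) *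
          jetG F (pderiv (c + 1) (monomial (Finsupp.single 0 (κ + 1)) 1)) x P = 0 := by
    refine Finset.sum_eq_zero fun c hc => ?_
    rw [pderiv_monomial, Finsupp.single_apply, if_neg (by omega)]
    simp [jetG]
  have h3 := opL_list hG x (fun l => P (l, 0)) κ []
  rw [List.map_nil, List.prod_nil] at h3
  rw [h2, hk, kOf_den _ _ _ (fun a => a.elim0), pderiv_monomial, kOf_sub_zero, kOf_zero, jetG,
    kOf_phi, ← smul_eq_C_mul, map_smul, smul_eq_mul, Finset.univ_eq_empty, Finset.prod_empty,
    Finset.prod_empty, Nat.add_sub_cancel, h3, Nat.factorial_succ]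
  have : (Nat.factorial κ : ℝ) ≠ 0 := by positivity
  have h' : (κ : ℝ) + 1 ≠ 0 := by positivity
  push_cast
  field_simp
  ring

end Helpers

/-- Closed formula for the κ-th prolongation coefficient `𝐘_κ^j` (one independent
variable, several dependent variables). -/
theorem prolongation_closed_formula_m
    (m : ℕ) (hm : 0 < m)
    (X : ℝ → (Fin m → ℝ) → ℝ) (Y : Fin m → ℝ → (Fin m → ℝ) → ℝ)
    (hX : ContDiff ℝ (⊤ : ℕ∞) (fun p : ℝ × (Fin m → ℝ) => X p.1 p.2))
    (hY : ∀ j, ContDiff ℝ (⊤ : ℕ∞) (fun p : ℝ × (Fin m → ℝ) => Y j p.1 p.2))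
    (j : Fin m) (κ : ℕ) (hκ : 1 ≤ κ) (x : ℝ) (P : Fin m × ℕ → ℝ) :
    prolongM X Y j κ x P =
      pdM κ [] (Y j) x (fun l => P (l, 0))
      + ∑ dm1 ∈ Finset.range (κ + 1),
        ∑ lam' ∈ (Fintype.piFinset fun _ : Fin (dm1 + 1) => Finset.range κ).filter
            (fun lam' => ∀ a b : Fin (dm1 + 1), a < b → lam' a < lam' b),
        ∑ mu' ∈ (Fintype.piFinset fun _ : Fin (dm1 + 1) => Finset.range (κ + 1)).filter
            (fun mu' => ∑ e, (mu' e + 1) * (lam' e + 1) ≤ κ + 1),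
        ∑ l : ((e : Fin (dm1 + 1)) × Fin (mu' e + 1)) → Fin m,
          ((Nat.descFactorial κ ((∑ e, (mu' e + 1) * (lam' e + 1)) - 1) : ℝ)
              / ((∏ e, (Nat.factorial (lam' e + 1)) ^ (mu' e + 1)
                    * Nat.factorial (mu' e + 1) : ℕ) : ℝ))
          * (((κ + 1 - ∑ e, (mu' e + 1) * (lam' e + 1) : ℕ) : ℝ)
                * pdM (κ - ∑ e, (mu' e + 1) * (lam' e + 1)) (blkList l) (Y j) x
                    (fun l' => P (l', 0))
              - ∑ e : Fin (dm1 + 1),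
                  kron j (l ⟨e, 0⟩) * (((mu' e + 1) * (lam' e + 1) : ℕ) : ℝ)
                    * pdM (κ + 1 - ∑ e', (mu' e' + 1) * (lam' e' + 1)) (blkListDrop l e) X x
                        (fun l' => P (l', 0)))
          * ∏ e : Fin (dm1 + 1), ∏ ν : Fin (mu' e + 1), P (l ⟨e, ν⟩, lam' e + 1) := by
  have hX' : SmM X := hX
  have hY' : ∀ j, SmM (Y j) := hY
  rw [prolong_eq' hX' hY', split_sum κ hκ _ (E_top x P j κ), E_bot (hY' j), ← reindex]
  congr 1
  refine Finset.sum_congr rfl fun d _ => Finset.sum_congr rfl fun lam hlam =>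
    Finset.sum_congr rfl fun mu hmu => ?_
  simp only [Finset.mem_filter, Fintype.mem_piFinset, Finset.mem_range] at hlam hmu
  exact (term_eq hX' (hY' j) x P j (Nat.succ_pos d)
    (StrictMono.injective (fun a b h => hlam.2 a b h)) hlam.1 hmu.2).symm
end

section
/- (Faà di Bruno formula, one independent variable and several dependent variables.) For every integer κ ≥ 1 and every x ∈ ℝ: d^κ h/dx^κ (x) = Σ_{d=1}^{κ} Σ_{1≤λ_1<⋯<λ_d≤κ} Σ_{μ_1≥1,…,μ_d≥1 with μ_1λ_1+⋯+μ_dλ_d = κ} ( κ! / ((λ_1!)^{μ_1} μ_1! ⋯ (λ_d!)^{μ_d} μ_d!) ) · Σ_{l_{1:1},…,l_{1:μ_1},…,l_{d:1},…,l_{d:μ_d} = 1}^{m} ∂^{μ_1+⋯+μ_d} f / (∂y^{l_{1:1}} ⋯ ∂y^{l_{1:μ_1}} ⋯ ∂y^{l_{d:1}} ⋯ ∂y^{l_{d:μ_d}}) evaluated at (g^1(x),…,g^m(x)), times Π_{e=1}^{d} Π_{ν=1}^{μ_e} d^{λ_e} g^{l_{e:ν}} / dx^{λ_e} (x). -/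
/-- Iterated partial derivative of `f : ℝᵐ → ℝ` with respect to the coordinates listed
in `ys`. -/
noncomputable def pdfl {m : ℕ} : List (Fin m) → ((Fin m → ℝ) → ℝ) → ((Fin m → ℝ) → ℝ)
  | [], F => F
  | a :: ls, F => fun y => deriv (fun t => pdfl ls F (Function.update y a t)) (y a)

namespace FDB
open Finset

theorem differentiable_itf {m : ℕ} {f : (Fin m → ℝ) → ℝ} (hf : ContDiff ℝ (⊤ : ℕ∞) f) (n : ℕ) :
    Differentiable ℝ (iteratedFDeriv ℝ n f) := by
  apply hf.differentiable_iteratedFDeriv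
  exact_mod_cast WithTop.coe_lt_top n

theorem pdfl_eq {m : ℕ} {f : (Fin m → ℝ) → ℝ} (hf : ContDiff ℝ (⊤ : ℕ∞) f) (L : List (Fin m)) :
    ∀ y, pdfl L f y = iteratedFDeriv ℝ L.length f y
      (fun i => Pi.single (L.get i) (1:ℝ)) := by
  induction L with
  | nil => intro y; simp [pdfl]
  | cons a L ih =>
    intro y
    have hd := differentiable_itf hf L.length
    have h1 : iteratedFDeriv ℝ (a :: L).length f y
      (fun i => Pi.single ((a :: L).get i) (1:ℝ)) = fderiv ℝ (fun y => pdfl L f y) y (Pi.single a 1) := by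
      rw [funext ih]
      exact (hd y).iteratedFDeriv_succ_apply_left' (m := fun i => Pi.single ((a :: L).get i) (1:ℝ))
    rw [h1]
    have hdp : Differentiable ℝ (fun y => pdfl L f y) := by
      rw [funext ih]
      intro y
      exact ((hd y).hasFDerivAt.continuousMultilinear_apply_const _).differentiableAt
    have h2 := hasDerivAt_update y a (y a)
    have h3 := (hdp (Function.update y a (y a))).hasFDerivAt.comp_hasDerivAt (y a) h2
    have := h3.deriv
    rw [Function.update_eq_self] at this
    exact this

theorem expand {m : ℕ} {f : (Fin m → ℝ) → ℝ} (hf : ContDiff ℝ (⊤ : ℕ∞) f) {ι : Type*}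
    [Fintype ι] [DecidableEq ι] (S : List ι) (hS : S.Nodup) (hS' : ∀ a, a ∈ S) (V : ι → Fin m → ℝ)
    (y : Fin m → ℝ) :
    iteratedFDeriv ℝ S.length f y (fun i => V (S.get i)) =
      ∑ l : ι → Fin m, pdfl (S.map l) f y * ∏ a, V a (l a) := by
  let e := List.Nodup.getEquivOfForallMemList S hS hS'
  have h1 : (fun i => V (S.get i)) = fun i => ∑ j, V (S.get i) j • (Pi.single j (1:ℝ) : Fin m → ℝ) := by
    funext i
    exact pi_eq_sum_univ' _
  rw [h1, ContinuousMultilinearMap.map_sum]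
  rw [← (Equiv.arrowCongr e (Equiv.refl (Fin m))).symm.sum_comp]
  apply sum_congr rfl
  intro l _
  rw [ContinuousMultilinearMap.map_smul_univ, pdfl_eq hf, smul_eq_mul, mul_comm]
  congr 1
  · have : ∀ (n : ℕ) (hn : n = S.length) (w : Fin n → Fin m → ℝ) (w' : Fin S.length → Fin m → ℝ),
      (∀ i, w i = w' (Fin.cast hn i)) → iteratedFDeriv ℝ S.length f y w' = iteratedFDeriv ℝ n f y w := by
      rintro n rfl w w' h
      congr 1
      funext i
      exact (h i).symm
    apply this _ (by simp)
    intro i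
    simp [e]
  · rw [← e.prod_comp]
    rfl

/-- value of the derivative along a tuple -/
noncomputable def TF {m : ℕ} (f : (Fin m → ℝ) → ℝ) (y : Fin m → ℝ) (G : ℕ → Fin m → ℝ)
    (L : List ℕ) : ℝ := iteratedFDeriv ℝ L.length f y (fun i => G (L.get i))

theorem TF_contDiff {m : ℕ} {f : (Fin m → ℝ) → ℝ} (hf : ContDiff ℝ (⊤ : ℕ∞) f)
    (G : ℕ → Fin m → ℝ) (L : List ℕ) : ContDiff ℝ (⊤ : ℕ∞) (fun y => TF f y G L) := by
  have h : ContDiff ℝ (⊤ : ℕ∞) (iteratedFDeriv ℝ L.length f) :=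
    hf.iteratedFDeriv_right (by norm_cast)
  exact (ContinuousMultilinearMap.apply ℝ (fun _ : Fin L.length => (Fin m → ℝ)) ℝ
    (fun i => G (L.get i))).contDiff.comp h

theorem TF_cons {m : ℕ} {f : (Fin m → ℝ) → ℝ} (hf : ContDiff ℝ (⊤ : ℕ∞) f)
    (G : ℕ → Fin m → ℝ) (a : ℕ) (L : List ℕ) (y : Fin m → ℝ) :
    TF f y G (a :: L) = fderiv ℝ (fun y => TF f y G L) y (G a) :=
  (differentiable_itf hf L.length y).iteratedFDeriv_succ_apply_left'
    (m := fun i => G ((a :: L).get i))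

theorem TF_perm {m : ℕ} {f : (Fin m → ℝ) → ℝ} (hf : ContDiff ℝ (⊤ : ℕ∞) f)
    (G : ℕ → Fin m → ℝ) {L L' : List ℕ} (h : L.Perm L') :
    ∀ y, TF f y G L = TF f y G L' := by
  induction h with
  | nil => intro y; rfl
  | cons a _ ih => intro y; rw [TF_cons hf, TF_cons hf, funext ih]
  | trans _ _ ih1 ih2 => intro y; rw [ih1, ih2]
  | swap a b L =>
    intro y
    have hc := TF_contDiff hf G L
    have hs : IsSymmSndFDerivAt ℝ (fun y => TF f y G L) y :=
      hc.contDiffAt.isSymmSndFDerivAt (by simp only [minSmoothness_of_isRCLikeNormedField]; exact WithTop.coe_le_coe.2 (le_top (a := (2 : ℕ∞))))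
    have hd : DifferentiableAt ℝ (fderiv ℝ (fun y => TF f y G L)) y :=
      (hc.fderiv_right (m := 1) (by norm_cast)).differentiable (by simp) y
    have key : ∀ a b, TF f y G (a :: b :: L) = fderiv ℝ (fderiv ℝ (fun y => TF f y G L)) y (G a) (G b) := by
      intro a b
      rw [TF_cons hf, funext (TF_cons hf G b L)]
      rw [fderiv_clm_apply hd (by fun_prop)]
      simp
    rw [key, key]
    exact hs.eq _ _

theorem TF_eq {m : ℕ} {f : (Fin m → ℝ) → ℝ} (hf : ContDiff ℝ (⊤ : ℕ∞) f) (y : Fin m → ℝ)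
    (G : ℕ → Fin m → ℝ) (L : List ℕ) (n : ℕ) (v : Fin n → ℕ)
    (h : (L : Multiset ℕ) = univ.val.map v) :
    TF f y G L = iteratedFDeriv ℝ n f y (fun i => G (v i)) := by
  have h2 : L.Perm (List.ofFn v) := by
    rw [← Multiset.coe_eq_coe, h]
    simp [List.ofFn_eq_map]
  rw [TF_perm hf G h2]
  have : ∀ (n' : ℕ) (hn : n' = n) (w' : Fin n' → Fin m → ℝ) (w : Fin n → Fin m → ℝ),
      (∀ i, w' i = w (Fin.cast hn i)) → iteratedFDeriv ℝ n' f y w' = iteratedFDeriv ℝ n f y w := by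
      rintro n rfl w w' h
      congr 1
      funext i
      exact (h i)
  apply this _ (by simp)
  intro i
  simp
  rfl

theorem iteratedDeriv_vec {m : ℕ} (g : Fin m → ℝ → ℝ) (hg : ∀ l, ContDiff ℝ (⊤ : ℕ∞) (g l)) (k : ℕ) :
    iteratedDeriv k (fun t l => g l t) = fun x l => iteratedDeriv k (g l) x := by
  induction k with
  | zero => simp
  | succ k ih =>
    funext x
    rw [iteratedDeriv_succ, ih, deriv_pi]
    · funext l
      rw [iteratedDeriv_succ]
    · intro l
      exact (hg l).differentiable_iteratedDeriv k (by exact_mod_cast WithTop.coe_lt_top k) x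

/-- multiset of part sizes (minus one) -/
def parts {n : ℕ} (c : OrderedFinpartition n) : Multiset ℕ :=
  univ.val.map (fun j => c.partSize j - 1)

theorem step1 {m : ℕ} (g : Fin m → ℝ → ℝ) (f : (Fin m → ℝ) → ℝ)
    (hg : ∀ l, ContDiff ℝ (⊤ : ℕ∞) (g l)) (hf : ContDiff ℝ (⊤ : ℕ∞) f) (κ : ℕ) (x : ℝ) :
    iteratedDeriv κ (fun t => f (fun l => g l t)) x = ∑ c : OrderedFinpartition κ,
      TF f (fun l => g l x) (fun k l => iteratedDeriv (k+1) (g l) x) (parts c).toList := by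
  have h := iteratedDeriv_vcomp_eq_sum_orderedFinpartition (n := ((⊤ : ℕ∞) : WithTop ℕ∞)) (i := κ) (x := x)
    (g := f) (f := fun t l => g l t) hf.contDiffAt (contDiff_pi.2 hg).contDiffAt
    (by exact_mod_cast le_top)
  refine h.trans (sum_congr rfl fun c _ => ?_)
  rw [TF_eq hf _ _ _ c.length (fun j => c.partSize j - 1) (by simp [parts])]
  congr 1
  funext j l
  rw [iteratedDeriv_vec g hg]
  have := c.partSize_pos j
  simp only []
  congr 1
  omega

theorem parts_left_aux (n : ℕ) (v : Fin n → ℕ) :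
    univ.val.map (fun j : Fin (n + 1) => (Fin.cons 1 v : Fin (n+1) → ℕ) j - 1) =
      0 ::ₘ univ.val.map (fun j => v j - 1) := by
  rw [Fin.univ_succ]
  simp only [cons_val, Multiset.map_cons, map_val, Multiset.map_map]
  rfl

theorem parts_left {n : ℕ} (c : OrderedFinpartition n) : parts c.extendLeft = 0 ::ₘ parts c :=
  parts_left_aux _ _

theorem parts_middle_aux (n : ℕ) (v : Fin n → ℕ) (k : Fin n) (hk : 0 < v k) :
    univ.val.map (fun j : Fin n => (Function.update v k (v k + 1)) j - 1) =
      (v k - 1 + 1) ::ₘ (univ.val.map (fun j => v j - 1)).erase (v k - 1) := by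
  have hu : (univ : Finset (Fin n)).val = k ::ₘ (univ.erase k).val := by
    rw [← Finset.cons_val (Finset.notMem_erase k univ)]
    congr 1
    ext; simp
  rw [hu]
  simp only [Multiset.map_cons, Function.update_self, Multiset.erase_cons_head]
  congr 1
  · omega
  · apply Multiset.map_congr rfl
    intro j hj
    rw [Function.update_of_ne]
    rintro rfl
    rw [Finset.mem_val] at hj
    exact Finset.notMem_erase _ _ hj

theorem parts_middle {n : ℕ} (c : OrderedFinpartition n) (k : Fin c.length) :
    parts (c.extendMiddle k) = (c.partSize k - 1 + 1) ::ₘ (parts c).erase (c.partSize k - 1) :=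
  parts_middle_aux _ _ _ (c.partSize_pos k)

theorem step2 (n : ℕ) (F : Multiset ℕ → ℝ) :
    ∑ c : OrderedFinpartition (n+1), F (parts c) = ∑ c : OrderedFinpartition n,
      (F (0 ::ₘ parts c) + ((parts c).map (fun j => F ((j+1) ::ₘ (parts c).erase j))).sum) := by
  rw [← (OrderedFinpartition.extendEquiv n).sum_comp, Fintype.sum_sigma]
  apply sum_congr rfl
  intro c _
  rw [Fintype.sum_option]
  simp only [OrderedFinpartition.extendEquiv_apply, OrderedFinpartition.extend_none,
    OrderedFinpartition.extend_some, parts_left, parts_middle]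
  congr 1
  conv_rhs => 
    arg 1
    arg 2
    unfold parts
  rw [Multiset.map_map]
  rfl

/-- the partitions of `n`, parts shifted by one -/
def P (n : ℕ) : Finset (Multiset ℕ) :=
  (univ : Finset (Nat.Partition n)).image (fun p => p.parts.map Nat.pred)

theorem mem_P (n : ℕ) (M : Multiset ℕ) : M ∈ P n ↔ (M.map Nat.succ).sum = n := by
  simp only [P, mem_image, mem_univ, true_and]
  constructor
  · rintro ⟨p, rfl⟩
    rw [Multiset.map_map, Multiset.map_congr (g := id) rfl, Multiset.map_id, p.parts_sum]
    intro x hx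
    exact Nat.succ_pred_eq_of_pos (p.parts_pos hx)
  · intro h
    refine ⟨⟨M.map Nat.succ, ?_, h⟩, ?_⟩
    · intro i hi
      obtain ⟨a, _, rfl⟩ := Multiset.mem_map.1 hi
      exact Nat.succ_pos a
    · simp

/-- denominator -/
def Z (M : Multiset ℕ) : ℕ :=
  ∏ j ∈ M.toFinset, (j+1).factorial ^ (M.count j) * (M.count j).factorial

theorem Z_pos (M : Multiset ℕ) : 0 < Z M := by
  unfold Z
  apply prod_pos
  intro i _
  positivity

theorem Z_sup (M : Multiset ℕ) (s : Finset ℕ) (h : M.toFinset ⊆ s) :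
  Z M = ∏ j ∈ s, (j+1).factorial ^ (M.count j) * (M.count j).factorial := by
  apply prod_subset h
  intro x _ hx
  rw [Multiset.mem_toFinset, ← Multiset.count_eq_zero] at hx
  simp [hx]

theorem Z_cons (j : ℕ) (M : Multiset ℕ) :
    Z (j ::ₘ M) = Z M * ((j+1).factorial * (M.count j + 1)) := by
  rw [Z_sup (j ::ₘ M) (insert j M.toFinset) (by simp), Z_sup M (insert j M.toFinset) (by simp)]
  rw [← mul_prod_erase _ _ (mem_insert_self j M.toFinset), ← mul_prod_erase _ _ (mem_insert_self j M.toFinset)]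
  have : ∀ i ∈ (insert j M.toFinset).erase j, (i+1).factorial ^ ((j ::ₘ M).count i) * ((j ::ₘ M).count i).factorial
    = (i+1).factorial ^ (M.count i) * (M.count i).factorial := by
    intro i hi
    rw [Multiset.count_cons_of_ne (by simp at hi; exact hi.1)]
  rw [prod_congr rfl this, Multiset.count_cons_self, pow_succ, Nat.factorial_succ (Multiset.count j M)]
  ring

theorem reindex (n : ℕ) (φ : ℕ → Multiset ℕ → ℝ) :
    ∑ N ∈ P n, ∑ j ∈ N.toFinset, φ j (N.erase j) = ∑ j ∈ range n, ∑ K ∈ P (n - 1 - j), φ j K := by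
  rw [sum_sigma', sum_sigma']
  refine sum_bij' (fun x _ => ⟨x.2, x.1.erase x.2⟩) (fun x _ => ⟨x.1 ::ₘ x.2, x.1⟩) ?_ ?_ ?_ ?_ ?_
  · rintro ⟨N, j⟩ h
    simp only [mem_sigma, mem_P, Multiset.mem_toFinset, mem_range] at h ⊢
    obtain ⟨h1, h2⟩ := h
    rw [← Multiset.cons_erase h2] at h1
    simp at h1 ⊢
    omega
  · rintro ⟨j, K⟩ h
    simp only [mem_sigma, mem_P, Multiset.mem_toFinset, mem_range] at h ⊢
    simp at h ⊢
    omega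
  · rintro ⟨N, j⟩ h
    simp only [mem_sigma, mem_P, Multiset.mem_toFinset] at h
    simp [Multiset.cons_erase h.2]
  · rintro ⟨j, K⟩ h
    simp
  · rintro ⟨N, j⟩ h
    rfl

theorem step3 (n : ℕ) (F : Multiset ℕ → ℝ) :
    ∑ M ∈ P n, ((n.factorial : ℝ) / Z M) *
      (F (0 ::ₘ M) + (M.map (fun j => F ((j+1) ::ₘ M.erase j))).sum)
    = ∑ N ∈ P (n+1), (((n+1).factorial : ℝ) / Z N) * F N := by
  have hR : ∑ N ∈ P (n+1), (((n+1).factorial : ℝ) / Z N) * F N =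
     ∑ N ∈ P (n+1), ∑ j ∈ N.toFinset,
      (fun j K => (n.factorial : ℝ) / (Z K * j.factorial) * F (j ::ₘ K)) j (N.erase j) := by
    apply sum_congr rfl
    intro N hN
    have hN' : ∑ j ∈ N.toFinset, (N.count j : ℝ) * (j + 1) = n + 1 := by
      have := (mem_P _ _).1 hN
      rw [Finset.sum_multiset_map_count] at this
      have h2 := congrArg (Nat.cast : ℕ → ℝ) this
      push_cast at h2
      simpa using h2
    have hn : ((n : ℝ) + 1) ≠ 0 := by positivity
    have hZ : (Z N : ℝ) ≠ 0 := by exact_mod_cast (Z_pos N).ne'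
    have e1 : (((n+1).factorial : ℝ) / Z N) * F N =
      ∑ j ∈ N.toFinset, ((N.count j : ℝ) * (j + 1)) * ((n.factorial : ℝ) / Z N * F N) := by
      rw [← sum_mul, hN', Nat.factorial_succ]
      push_cast
      ring
    rw [e1]
    apply sum_congr rfl
    intro j hj
    rw [Multiset.mem_toFinset] at hj
    simp only []
    obtain ⟨K, rfl⟩ := Multiset.exists_cons_of_mem hj
    have hK : (Z K : ℝ) ≠ 0 := by exact_mod_cast (Z_pos K).ne'
    rw [Multiset.erase_cons_head, Multiset.count_cons_self, Z_cons, Nat.factorial_succ]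
    push_cast
    have : (j.factorial : ℝ) ≠ 0 := by positivity
    have : ((K.count j : ℝ) + 1) ≠ 0 := by positivity
    have : ((j : ℝ) + 1) ≠ 0 := by positivity
    field_simp
  have hL : ∑ M ∈ P n, ((n.factorial : ℝ) / Z M) * (M.map (fun j => F ((j+1) ::ₘ M.erase j))).sum
    = ∑ M ∈ P n, ∑ j ∈ M.toFinset,
      (fun j K => (n.factorial : ℝ) / (Z K * (j+1).factorial) * F ((j+1) ::ₘ K)) j (M.erase j) := by
    apply sum_congr rfl
    intro M hM
    rw [Finset.sum_multiset_map_count, mul_sum]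
    apply sum_congr rfl
    intro j hj
    rw [Multiset.mem_toFinset] at hj
    simp only []
    obtain ⟨K, rfl⟩ := Multiset.exists_cons_of_mem hj
    have hK : (Z K : ℝ) ≠ 0 := by exact_mod_cast (Z_pos K).ne'
    rw [Multiset.erase_cons_head, Multiset.count_cons_self, Z_cons, nsmul_eq_mul]
    push_cast
    have : ((j+1).factorial : ℝ) ≠ 0 := by positivity
    have : ((K.count j : ℝ) + 1) ≠ 0 := by positivity
    field_simp
  simp only [mul_add, sum_add_distrib]
  rw [hL, hR,
    reindex n (fun j K => (n.factorial : ℝ) / (Z K * (j+1).factorial) * F ((j+1) ::ₘ K)),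
    reindex (n+1) (fun j K => (n.factorial : ℝ) / (Z K * j.factorial) * F (j ::ₘ K)),
    sum_range_succ', add_comm]
  have h1 : ∀ j, n + 1 - 1 - (j + 1) = n - 1 - j := by intro j; omega
  have h2 : n + 1 - 1 - 0 = n := by omega
  simp only [h1, h2, Nat.factorial_zero, Nat.cast_one, mul_one]

theorem step4 (n : ℕ) : ∀ (F : Multiset ℕ → ℝ),
    ∑ c : OrderedFinpartition n, F (parts c) = ∑ N ∈ P n, ((n.factorial : ℝ) / Z N) * F N := by
  induction n with
  | zero =>
    intro F
    have : P 0 = {0} := by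
      ext M
      rw [mem_P]
      constructor
      · intro h
        rw [Multiset.sum_eq_zero_iff] at h
        rw [mem_singleton]
        apply Multiset.eq_zero_of_forall_notMem
        intro a ha
        have := h _ (Multiset.mem_map_of_mem Nat.succ ha)
        simp at this
      · intro h
        rw [mem_singleton] at h
        simp [h]
    rw [this, Fintype.sum_unique]
    simp [Z, parts]
  | succ n ih =>
    intro F
    rw [step2, ih (fun M => F (0 ::ₘ M) + (M.map (fun j => F ((j+1) ::ₘ M.erase j))).sum), step3]

/-- the list of all block labels -/
def SL {d : ℕ} (mu : Fin d → ℕ) : List ((e : Fin d) × Fin (mu e + 1)) :=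
  ((List.finRange d).map (fun e => List.ofFn (fun ν : Fin (mu e + 1) => ⟨e, ν⟩))).flatten

theorem blkList_eq {m d : ℕ} {mu : Fin d → ℕ} (l : ((e : Fin d) × Fin (mu e + 1)) → Fin m) :
    blkList l = (SL mu).map l := by
  simp only [blkList, SL, List.map_flatten, List.map_map]
  congr 2
  funext e
  simp [List.map_ofFn, Function.comp_def]

theorem SL_mem {d : ℕ} (mu : Fin d → ℕ) (a) : a ∈ SL mu := by
  obtain ⟨e, ν⟩ := a
  rw [SL, List.mem_flatten]
  exact ⟨_, List.mem_map.2 ⟨e, List.mem_finRange e, rfl⟩, List.mem_ofFn.2 ⟨ν, rfl⟩⟩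

theorem SL_nodup {d : ℕ} (mu : Fin d → ℕ) : (SL mu).Nodup := by
  unfold SL
  rw [List.nodup_flatten]
  constructor
  · intro L hL
    obtain ⟨e, _, rfl⟩ := List.mem_map.1 hL
    rw [List.nodup_ofFn]
    intro a b h
    simpa using h
  · rw [List.pairwise_map]
    apply (List.nodup_finRange d).imp
    intro a b hab x hx hy
    rw [List.mem_ofFn] at hx hy
    obtain ⟨i, rfl⟩ := hx
    obtain ⟨j, hj⟩ := hy
    exact hab (congrArg Sigma.fst hj).symm

/-- the multiset attached to `(λ, μ)` -/
def NT {d : ℕ} (lam mu : Fin d → ℕ) : Multiset ℕ :=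
  ∑ e, Multiset.replicate (mu e + 1) (lam e)

theorem coe_flat {ι : Type*} (L : List ι) (φ : ι → List ℕ) :
    (((L.map φ).flatten : List ℕ) : Multiset ℕ) = (L.map (fun e => (φ e : Multiset ℕ))).sum := by
  induction L with
  | nil => simp
  | cons a L ih => simp [← ih, ← Multiset.coe_add]

theorem NT_eq {d : ℕ} (lam mu : Fin d → ℕ) :
    (((SL mu).map (fun a => lam a.1) : List ℕ) : Multiset ℕ) = NT lam mu := by
  rw [NT, Fin.sum_univ_def, SL, List.map_flatten, List.map_map, coe_flat]
  congr 2
  funext e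
  simp only [Function.comp_def, List.map_ofFn, List.ofFn_const]
  rfl

theorem NT_count {d : ℕ} (lam mu : Fin d → ℕ) (h : StrictMono lam) (e : Fin d) :
    (NT lam mu).count (lam e) = mu e + 1 := by
  rw [NT, Multiset.count_sum', sum_eq_single e]
  · simp
  · intro b _ hb
    rw [Multiset.count_replicate, if_neg]
    intro h'
    exact hb (h.injective h')
  · simp

theorem NT_mem {d : ℕ} (lam mu : Fin d → ℕ) (k : ℕ) : k ∈ NT lam mu ↔ ∃ e, lam e = k := by
  rw [NT, Multiset.mem_sum]
  constructor
  · rintro ⟨e, _, h⟩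
    exact ⟨e, (Multiset.eq_of_mem_replicate h).symm⟩
  · rintro ⟨e, rfl⟩
    exact ⟨e, mem_univ e, Multiset.mem_replicate.2 ⟨Nat.succ_ne_zero _, rfl⟩⟩

theorem NT_toFinset {d : ℕ} (lam mu : Fin d → ℕ) : (NT lam mu).toFinset = univ.image lam := by
  ext k
  simp [NT_mem]

theorem NT_Z {d : ℕ} (lam mu : Fin d → ℕ) (h : StrictMono lam) :
    Z (NT lam mu) = ∏ e, (lam e + 1).factorial ^ (mu e + 1) * (mu e + 1).factorial := by
  rw [Z, NT_toFinset, prod_image h.injective.injOn]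
  simp only [NT_count lam mu h]

theorem NT_sum {d : ℕ} (lam mu : Fin d → ℕ) :
    ((NT lam mu).map Nat.succ).sum = ∑ e, (mu e + 1) * (lam e + 1) := by
  rw [NT, ← Multiset.coe_mapAddMonoidHom, map_sum, ← Multiset.coe_sumAddMonoidHom, map_sum]
  apply sum_congr rfl
  intro e _
  simp
  ring

theorem TF_NT {m : ℕ} {f : (Fin m → ℝ) → ℝ} (hf : ContDiff ℝ (⊤ : ℕ∞) f) (y : Fin m → ℝ)
    (G : ℕ → Fin m → ℝ) {d : ℕ} (lam mu : Fin d → ℕ) :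
    TF f y G (NT lam mu).toList =
      ∑ l : ((e : Fin d) × Fin (mu e + 1)) → Fin m,
        pdfl (blkList l) f y * ∏ e : Fin d, ∏ ν : Fin (mu e + 1), G (lam e) (l ⟨e, ν⟩) := by
  rw [TF_eq hf y G _ (SL mu).length (fun i => lam ((SL mu).get i).1)]
  · rw [expand hf (SL mu) (SL_nodup mu) (SL_mem mu) (fun a => G (lam a.1))]
    apply sum_congr rfl
    intro l _
    rw [blkList_eq, Fintype.prod_sigma]
  · rw [Multiset.coe_toList, ← NT_eq]
    have : (univ.val : Multiset (Fin (SL mu).length)).map (SL mu).get = (SL mu : Multiset _) := by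
      simp
    rw [← Multiset.map_coe, ← this, Multiset.map_map]
    rfl

theorem NT_inj {d d' : ℕ} (lam mu : Fin d → ℕ) (lam' mu' : Fin d' → ℕ) (h : StrictMono lam)
    (h' : StrictMono lam') (hN : NT lam mu = NT lam' mu') :
    d = d' ∧ HEq lam lam' ∧ HEq mu mu' := by
  have hT : univ.image lam = univ.image lam' := by
    rw [← NT_toFinset lam mu, hN, NT_toFinset]
  have hd : d = d' := by
    have := congrArg card hT
    rw [card_image_of_injective _ h.injective, card_image_of_injective _ h'.injective] at this
    simpa using this
  subst hd
  have hl : lam = lam' := by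
    apply (StrictMono.range_inj h h').1
    have := congrArg (fun s : Finset ℕ => (s : Set ℕ)) hT
    simpa using this
  subst hl
  refine ⟨rfl, HEq.rfl, heq_of_eq ?_⟩
  funext e
  have h1 := NT_count lam mu h e
  rw [hN, NT_count lam mu' h e] at h1
  omega

theorem NT_surj (N : Multiset ℕ) (d : ℕ) (hd : N.toFinset.card = d) :
    ∃ lam mu : Fin d → ℕ, StrictMono lam ∧ NT lam mu = N := by
  let lam := N.toFinset.orderEmbOfFin hd
  have hl : StrictMono lam := lam.strictMono
  have hmem : ∀ e, lam e ∈ N := fun e => Multiset.mem_toFinset.1 (orderEmbOfFin_mem _ hd e)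
  refine ⟨lam, fun e => N.count (lam e) - 1, hl, ?_⟩
  ext k
  by_cases hk : k ∈ N
  · have : k ∈ Set.range lam := by
      rw [range_orderEmbOfFin]
      simpa using hk
    obtain ⟨e, rfl⟩ := this
    rw [NT_count _ _ hl]
    have := Multiset.count_pos.2 hk
    omega
  · rw [Multiset.count_eq_zero_of_notMem hk, Multiset.count_eq_zero, NT_mem]
    rintro ⟨e, rfl⟩
    exact hk (hmem e)

theorem bounds {κ d : ℕ} (lam mu : Fin d → ℕ) (h : ∑ e, (mu e + 1) * (lam e + 1) = κ) :
    d ≤ κ ∧ (∀ e, lam e < κ) ∧ (∀ e, mu e < κ) := by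
  have h1 : ∀ e, (mu e + 1) * (lam e + 1) ≤ κ := by
    intro e
    rw [← h]
    exact single_le_sum (f := fun e => (mu e + 1) * (lam e + 1)) (fun _ _ => Nat.zero_le _) (mem_univ e)
  refine ⟨?_, ?_, ?_⟩
  · rw [← h]
    calc d = ∑ e : Fin d, 1 := by simp
      _ ≤ _ := sum_le_sum (fun e _ => Nat.mul_pos (Nat.succ_pos _) (Nat.succ_pos _))
  · intro e
    nlinarith [h1 e, Nat.zero_le (mu e * lam e)]
  · intro e
    nlinarith [h1 e, Nat.zero_le (mu e * lam e)]

theorem step5 (κ : ℕ) (hκ : 1 ≤ κ) (Φ : Multiset ℕ → ℝ) :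
    ∑ N ∈ P κ, Φ N =
      ∑ dm1 ∈ Finset.range κ,
        ∑ lam' ∈ (Fintype.piFinset fun _ : Fin (dm1 + 1) => Finset.range κ).filter
            (fun lam' => ∀ a b : Fin (dm1 + 1), a < b → lam' a < lam' b),
        ∑ mu' ∈ (Fintype.piFinset fun _ : Fin (dm1 + 1) => Finset.range κ).filter
            (fun mu' => ∑ e, (mu' e + 1) * (lam' e + 1) = κ), Φ (NT lam' mu') := by
  symm
  simp_rw [sum_sigma']
  refine sum_bij (fun x _ => NT x.2.1 x.2.2) ?_ ?_ ?_ ?_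
  · rintro ⟨d, lam, mu⟩ h
    simp only [mem_sigma, mem_filter] at h
    rw [mem_P, NT_sum]
    exact h.2.2.2
  · rintro ⟨d, lam, mu⟩ h ⟨d', lam', mu'⟩ h' hN
    simp only [mem_sigma, mem_filter] at h h'
    obtain ⟨hd, hl, hm⟩ := NT_inj lam mu lam' mu' (fun a b => h.2.1.2 a b) (fun a b => h'.2.1.2 a b) hN
    obtain rfl : d = d' := by omega
    obtain rfl := eq_of_heq hl
    obtain rfl := eq_of_heq hm
    rfl
  · intro N hN
    rw [mem_P] at hN
    have hc : 0 < N.toFinset.card := by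
      rw [card_pos, nonempty_iff_ne_empty]
      intro h0
      rw [Multiset.toFinset_eq_empty] at h0
      subst h0
      simp at hN
      omega
    obtain ⟨lam, mu, hl, hNT⟩ := NT_surj N (N.toFinset.card - 1 + 1) (by omega)
    rw [← hNT, NT_sum] at hN
    obtain ⟨b1, b2, b3⟩ := bounds lam mu hN
    refine ⟨⟨_, lam, mu⟩, ?_, hNT⟩
    simp only [mem_sigma, mem_filter, Fintype.mem_piFinset, mem_range]
    exact ⟨by omega, ⟨b2, fun a b => @hl a b⟩, b3, hN⟩
  · intros; rfl

end FDB


/-- The Faà di Bruno formula for `h(x) = f(g¹(x),…,gᵐ(x))`: one independent variable and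
several dependent variables. -/
theorem faa_di_bruno_several_dependent_variables
    (m : ℕ) (hm : 0 < m) (g : Fin m → ℝ → ℝ) (f : (Fin m → ℝ) → ℝ)
    (hg : ∀ l, ContDiff ℝ (⊤ : ℕ∞) (g l)) (hf : ContDiff ℝ (⊤ : ℕ∞) f)
    (κ : ℕ) (hκ : 1 ≤ κ) (x : ℝ) :
    iteratedDeriv κ (fun t => f (fun l => g l t)) x =
      ∑ dm1 ∈ Finset.range κ,
        ∑ lam' ∈ (Fintype.piFinset fun _ : Fin (dm1 + 1) => Finset.range κ).filter
            (fun lam' => ∀ a b : Fin (dm1 + 1), a < b → lam' a < lam' b),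
        ∑ mu' ∈ (Fintype.piFinset fun _ : Fin (dm1 + 1) => Finset.range κ).filter
            (fun mu' => ∑ e, (mu' e + 1) * (lam' e + 1) = κ),
          ((κ.factorial : ℝ)
              / ((∏ e, (Nat.factorial (lam' e + 1)) ^ (mu' e + 1)
                    * Nat.factorial (mu' e + 1) : ℕ) : ℝ))
          * ∑ l : ((e : Fin (dm1 + 1)) × Fin (mu' e + 1)) → Fin m,
              pdfl (blkList l) f (fun l' => g l' x)
                * ∏ e : Fin (dm1 + 1), ∏ ν : Fin (mu' e + 1),
                    iteratedDeriv (lam' e + 1) (g (l ⟨e, ν⟩)) x := by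
  classical
  rw [FDB.step1 g f hg hf κ x,
    FDB.step4 κ (fun M => FDB.TF f (fun l => g l x)
      (fun k l => iteratedDeriv (k+1) (g l) x) M.toList),
    FDB.step5 κ hκ]
  refine Finset.sum_congr rfl fun d _ => Finset.sum_congr rfl fun lam hlam =>
    Finset.sum_congr rfl fun mu _ => ?_
  have hl : StrictMono lam := fun a b => (Finset.mem_filter.1 hlam).2 a b
  rw [FDB.NT_Z lam mu hl, FDB.TF_NT hf]
end
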